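/- Let n ≥ 1, let 1 < q < p < r < ∞ and 1 ≤ τ < ∞. Let 1 < p₀ < ∞ and let N : [1,∞) → (0,∞) be increasing. Then there exists a constant C > 0 such that ‖f‖_{BM^{p,τ}_{q,r}} ≤ C‖g‖_{BM^{p,τ}_{q,r}} for every pair (f,g) ∈ F(p₀,N), where the Besov–Bourgain–Morrey norm is ‖h‖_{BM^{p,τ}_{q,r}} := ( ∑_{ν∈ℤ} ( ∑_{m∈ℤⁿ} ( |Q_{ν,m}|^{1/p − 1/q} (∫_{Q_{ν,m}} |h(y)|^q dy)^{1/q} )^r )^{τ/r} )^{1/τ}, with dyadic cubes Q_{ν,m} := ∏_{i=1}^n [2^{−ν} m_i, 2^{−ν}(m_i+1)]. -/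

import Mathlib

open MeasureTheory ENNReal NNReal Filter Topology

noncomputable section

/-- Euclidean space ℝⁿ. -/
abbrev Eucl (n : ℕ) := EuclideanSpace ℝ (Fin n)

/-- The axes-parallel closed cube with center `x` and radius `r`. -/
def cubeSet {n : ℕ} (x : Eucl n) (r : ℝ) : Set (Eucl n) :=
  {y | ∀ i, |x i - y i| ≤ r}

/-- The Muckenhoupt `A_p` characteristic
`[w]_{A_p} = sup_Q (|Q|⁻¹∫_Q w) (|Q|⁻¹∫_Q w^{-1/(p-1)})^{p-1}`. -/
def apConst (n : ℕ) (p : ℝ) (w : Eucl n → ℝ≥0∞) : ℝ≥0∞ :=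
  ⨆ (x : Eucl n) (r : ℝ) (_ : 0 < r),
    ((volume (cubeSet x r))⁻¹ * ∫⁻ y in cubeSet x r, w y) *
      ((volume (cubeSet x r))⁻¹ * ∫⁻ y in cubeSet x r, w y ^ (-(1/(p-1)))) ^ (p-1)

/-- A weight: measurable, positive and finite a.e. -/
def IsWeight {n : ℕ} (w : Eucl n → ℝ≥0∞) : Prop :=
  Measurable w ∧ ∀ᵐ x ∂(volume : Measure (Eucl n)), 0 < w x ∧ w x < ⊤

/-- `w ∈ A_p`. -/
def MemAp (n : ℕ) (p : ℝ) (w : Eucl n → ℝ≥0∞) : Prop :=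
  IsWeight w ∧ apConst n p w < ⊤

/-- The weighted Lebesgue norm, for an `ℝ≥0∞`-valued function. -/
def wLpE (n : ℕ) (p : ℝ) (w : Eucl n → ℝ≥0∞) (F : Eucl n → ℝ≥0∞) : ℝ≥0∞ :=
  (∫⁻ x, F x ^ p * w x) ^ (1/p)

/-- The weighted Lebesgue norm `‖f‖_{L^p(w)} = (∫ |f|^p w)^{1/p}`. -/
def wLp (n : ℕ) (p : ℝ) (w : Eucl n → ℝ≥0∞) (f : Eucl n → ℝ) : ℝ≥0∞ :=
  wLpE n p w (fun x => (‖f x‖₊ : ℝ≥0∞))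

/-- The extrapolation family `F(p,N)`: pairs of measurable functions `(f,g)` with
`‖f‖_{L^p(w)} ≤ N([w]_{A_p}) ‖g‖_{L^p(w)}` for every `w ∈ A_p`. -/
def memF (n : ℕ) (p : ℝ) (N : ℝ → ℝ) (f g : Eucl n → ℝ) : Prop :=
  Measurable f ∧ Measurable g ∧
    ∀ w : Eucl n → ℝ≥0∞, MemAp n p w →
      wLp n p w f ≤ ENNReal.ofReal (N ((apConst n p w).toReal)) * wLp n p w g

/-- The dyadic cube `Q_{j,k} = ∏_m [2^{-j} k_m, 2^{-j}(k_m+1)]`. -/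
def dyCube (n : ℕ) (j : ℤ) (k : Fin n → ℤ) : Set (Eucl n) :=
  {x | ∀ i, x i ∈ Set.Icc ((2 : ℝ) ^ (-j) * k i) ((2 : ℝ) ^ (-j) * (k i + 1))}

/-- The Besov–Bourgain–Morrey norm `‖h‖_{BM^{p,τ}_{q,r}}`. -/
def bbmNorm (n : ℕ) (p q r τ : ℝ) (h : Eucl n → ℝ) : ℝ≥0∞ :=
  (∑' ν : ℤ, (∑' m : Fin n → ℤ,
      (volume (dyCube n ν m) ^ (1/p - 1/q) *
        (∫⁻ y in dyCube n ν m, (‖h y‖₊ : ℝ≥0∞) ^ q) ^ (1/q)) ^ r) ^ (τ/r)) ^ (1/τ)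

namespace BBMAux

/-- volume of a sup-norm ball of radius r -/
def cv (n : ℕ) (r : ℝ) : ℝ≥0∞ := ENNReal.ofReal ((2 * r) ^ n)

lemma vol_cb {n : ℕ} (c : Fin n → ℝ) {r : ℝ} (hr : 0 ≤ r) :
    volume (Metric.closedBall c r) = cv n r := by
  rw [Real.volume_pi_closedBall c hr, cv, Fintype.card_fin]

lemma cv_ne_zero {n : ℕ} {r : ℝ} (hr : 0 < r) : cv n r ≠ 0 := by
  unfold cv
  have : 0 < (2 * r) ^ n := by positivity
  simpa using this

lemma cv_ne_top {n : ℕ} {r : ℝ} : cv n r ≠ ∞ := ENNReal.ofReal_ne_top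

lemma cv_mul {n : ℕ} {r t : ℝ} (ht : 0 ≤ t) :
    cv n (t * r) = ENNReal.ofReal (t ^ n) * cv n r := by
  unfold cv
  rw [← ENNReal.ofReal_mul (by positivity)]
  congr 1
  rw [← mul_pow]; ring

lemma cv_mono {n : ℕ} {r t : ℝ} (hr : 0 ≤ r) (ht : r ≤ t) : cv n r ≤ cv n t := by
  unfold cv
  apply ENNReal.ofReal_le_ofReal
  gcongr

/-- average over a cube -/
def av {n : ℕ} (f : (Fin n → ℝ) → ℝ≥0∞) (c : Fin n → ℝ) (r : ℝ) : ℝ≥0∞ :=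
  (cv n r)⁻¹ * ∫⁻ y in Metric.closedBall c r, f y

/-- uncentered maximal function -/
def mx {n : ℕ} (f : (Fin n → ℝ) → ℝ≥0∞) (x : Fin n → ℝ) : ℝ≥0∞ :=
  ⨆ (c : Fin n → ℝ) (r : ℝ) (_ : 0 < r) (_ : x ∈ Metric.ball c r), av f c r

lemma av_le_mx {n : ℕ} (f : (Fin n → ℝ) → ℝ≥0∞) {c x : Fin n → ℝ} {r : ℝ} (hr : 0 < r)
    (hx : x ∈ Metric.ball c r) : av f c r ≤ mx f x :=
  le_iSup_of_le c (le_iSup_of_le r (le_iSup_of_le hr (le_iSup_of_le hx le_rfl)))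

lemma mx_le {n : ℕ} {f : (Fin n → ℝ) → ℝ≥0∞} {x : Fin n → ℝ} {A : ℝ≥0∞}
    (h : ∀ c r, 0 < r → x ∈ Metric.ball c r → av f c r ≤ A) : mx f x ≤ A :=
  iSup_le fun c => iSup_le fun r => iSup_le fun hr => iSup_le fun hx => h c r hr hx

lemma lt_mx {n : ℕ} {f : (Fin n → ℝ) → ℝ≥0∞} {x : Fin n → ℝ} {A : ℝ≥0∞} (h : A < mx f x) :
    ∃ c r, 0 < r ∧ x ∈ Metric.ball c r ∧ A < av f c r := by
  by_contra hcon
  push Not at hcon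
  exact absurd (mx_le hcon) (not_le.mpr h)

lemma av_mono {n : ℕ} {f g : (Fin n → ℝ) → ℝ≥0∞} (h : ∀ x, f x ≤ g x) (c : Fin n → ℝ) (r : ℝ) :
    av f c r ≤ av g c r := by
  unfold av
  gcongr
  exact h _

lemma mx_mono {n : ℕ} {f g : (Fin n → ℝ) → ℝ≥0∞} (h : ∀ x, f x ≤ g x) (x : Fin n → ℝ) :
    mx f x ≤ mx g x :=
  mx_le fun c r hr hx => (av_mono h c r).trans (av_le_mx g hr hx)

lemma av_add {n : ℕ} {f g : (Fin n → ℝ) → ℝ≥0∞} (hf : Measurable f) (c : Fin n → ℝ) (r : ℝ) :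
    av (fun x => f x + g x) c r = av f c r + av g c r := by
  unfold av
  rw [lintegral_add_left hf, mul_add]

lemma mx_add_le {n : ℕ} {f g : (Fin n → ℝ) → ℝ≥0∞} (hf : Measurable f) (x : Fin n → ℝ) :
    mx (fun x => f x + g x) x ≤ mx f x + mx g x :=
  mx_le fun c r hr hx => by
    rw [av_add hf]
    exact add_le_add (av_le_mx f hr hx) (av_le_mx g hr hx)

lemma av_le_of_le {n : ℕ} {f : (Fin n → ℝ) → ℝ≥0∞} {c : Fin n → ℝ} {r : ℝ} (hr : 0 < r)
    {A : ℝ≥0∞} (h : ∀ x ∈ Metric.closedBall c r, f x ≤ A) : av f c r ≤ A := by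
  unfold av
  calc (cv n r)⁻¹ * ∫⁻ y in Metric.closedBall c r, f y
      ≤ (cv n r)⁻¹ * ∫⁻ y in Metric.closedBall c r, A := by
        gcongr 1
        exact setLIntegral_mono measurable_const h
    _ = A := by
        rw [setLIntegral_const, vol_cb c hr.le, mul_comm A, ← mul_assoc,
          ENNReal.inv_mul_cancel (cv_ne_zero hr) cv_ne_top, one_mul]

lemma mx_le_of_le {n : ℕ} {f : (Fin n → ℝ) → ℝ≥0∞} {A : ℝ≥0∞} (h : ∀ x, f x ≤ A)
    (x : Fin n → ℝ) : mx f x ≤ A :=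
  mx_le fun _ _ hr _ => av_le_of_le hr fun y _ => h y

lemma isOpen_mx {n : ℕ} (f : (Fin n → ℝ) → ℝ≥0∞) (A : ℝ≥0∞) : IsOpen {x | A < mx f x} := by
  rw [isOpen_iff_forall_mem_open]
  intro x hx
  obtain ⟨c, r, hr, hxc, hA⟩ := lt_mx hx
  exact ⟨Metric.ball c r, fun y hy => lt_of_lt_of_le hA (av_le_mx f hr hy), Metric.isOpen_ball, hxc⟩

lemma measurable_mx {n : ℕ} (f : (Fin n → ℝ) → ℝ≥0∞) : Measurable (mx f) :=
  measurable_of_Ioi fun A => (isOpen_mx f A).measurableSet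

/-- average over a smaller ball is controlled by that over a bigger one -/
lemma av_le_scale {n : ℕ} (f : (Fin n → ℝ) → ℝ≥0∞) {c c' : Fin n → ℝ} {r t : ℝ}
    (ht : 0 < t) (hsub : Metric.closedBall c r ⊆ Metric.closedBall c' (t * r)) :
    av f c r ≤ ENNReal.ofReal (t ^ n) * av f c' (t * r) := by
  unfold av
  have h1 : ENNReal.ofReal (t ^ n) ≠ 0 := by
    have : 0 < t ^ n := by positivity
    simpa using this
  rw [cv_mul ht.le, ENNReal.mul_inv (Or.inl h1) (Or.inl ENNReal.ofReal_ne_top), ← mul_assoc,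
    ← mul_assoc, ENNReal.mul_inv_cancel h1 ENNReal.ofReal_ne_top, one_mul]
  gcongr

/-- pointwise A1 condition -/
def A1 {n : ℕ} (K : ℝ≥0∞) (w : (Fin n → ℝ) → ℝ≥0∞) : Prop :=
  ∀ c r, 0 < r → ∀ x ∈ Metric.closedBall c r, av w c r ≤ K * w x

lemma A1_one {n : ℕ} : A1 (n := n) 1 (fun _ => 1) := by
  intro c r hr x _
  simpa using av_le_of_le (f := fun _ : Fin n → ℝ => (1 : ℝ≥0∞)) (c := c) hr (fun _ _ => le_rfl)

lemma weak_ball {n : ℕ} {K : ℝ≥0∞} {w f : (Fin n → ℝ) → ℝ≥0∞} (hw : A1 K w)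
    (hwm : Measurable w) (hf : Measurable f)
    {t : ℝ≥0∞} {c : Fin n → ℝ} {r : ℝ} (hr : 0 < r) (h : t < av f c r) :
    t * ∫⁻ y in Metric.closedBall c (4 * r), w y ≤
      ENNReal.ofReal (4 ^ n) * K * ∫⁻ y in Metric.closedBall c r, f y * w y := by
  have h4 : (0:ℝ) < 4 * r := by positivity
  have hsub : Metric.closedBall c r ⊆ Metric.closedBall c (4 * r) :=
    Metric.closedBall_subset_closedBall (by linarith)
  set I := ∫⁻ y in Metric.closedBall c (4 * r), w y with hI
  have h1 : ∀ y ∈ Metric.closedBall c r, I ≤ cv n (4 * r) * (K * w y) := by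
    intro y hy
    have := hw c (4 * r) h4 y (hsub hy)
    unfold av at this
    rw [mul_comm, ← div_eq_mul_inv, ENNReal.div_le_iff (cv_ne_zero h4) cv_ne_top] at this
    rw [mul_comm (cv n (4 * r))]
    exact this
  calc t * I ≤ av f c r * I := by gcongr
    _ = (cv n r)⁻¹ * ((∫⁻ y in Metric.closedBall c r, f y) * I) := by unfold av; ring
    _ ≤ (cv n r)⁻¹ * ∫⁻ y in Metric.closedBall c r, f y * I := by
        gcongr; exact lintegral_mul_const_le _ _
    _ ≤ (cv n r)⁻¹ * ∫⁻ y in Metric.closedBall c r, (cv n (4 * r) * K) * (f y * w y) := by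
        gcongr 1
        apply setLIntegral_mono' Metric.isClosed_closedBall.measurableSet
        intro y hy
        calc f y * I ≤ f y * (cv n (4 * r) * (K * w y)) := by gcongr; exact h1 y hy
          _ = _ := by ring
    _ = _ := by
        rw [lintegral_const_mul _ (by fun_prop), cv_mul (by norm_num), ← mul_assoc]
        congr 1
        calc (cv n r)⁻¹ * (ENNReal.ofReal (4 ^ n) * cv n r * K)
            = ((cv n r)⁻¹ * cv n r) * (ENNReal.ofReal (4 ^ n) * K) := by ring
          _ = _ := by rw [ENNReal.inv_mul_cancel (cv_ne_zero hr) cv_ne_top, one_mul]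

lemma weak_type {n : ℕ} {K : ℝ≥0∞} {w f : (Fin n → ℝ) → ℝ≥0∞} (hw : A1 K w)
    (hwm : Measurable w) (hf : Measurable f) (t : ℝ≥0∞) :
    t * volume.withDensity w {x | t < mx f x} ≤
      ENNReal.ofReal (4 ^ n) * K * ∫⁻ y, f y * w y := by
  set μ := volume.withDensity w with hμ
  let E : ℕ → Set (Fin n → ℝ) := fun N =>
    {x | ∃ (c : Fin n → ℝ) (r : ℝ), 0 < r ∧ r ≤ N ∧ x ∈ Metric.ball c r ∧ t < av f c r}
  have hE : {x | t < mx f x} = ⋃ N, E N := by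
    ext x
    simp only [Set.mem_ofPred_eq, Set.mem_iUnion, E]
    constructor
    · intro h
      obtain ⟨c, r, hr, hx, hA⟩ := lt_mx h
      obtain ⟨N, hN⟩ := exists_nat_ge r
      exact ⟨N, c, r, hr, hN, hx, hA⟩
    · rintro ⟨N, c, r, hr, -, hx, hA⟩
      exact lt_of_lt_of_le hA (av_le_mx f hr hx)
  have hmono : Monotone E := by
    intro N M hNM x hx
    obtain ⟨c, r, hr, hN, hx, hA⟩ := hx
    exact ⟨c, r, hr, hN.trans (by exact_mod_cast hNM), hx, hA⟩
  rw [hE, hmono.measure_iUnion, ENNReal.mul_iSup]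
  refine iSup_le fun N => ?_
  let T : Set ((Fin n → ℝ) × ℝ) := {a | 0 < a.2 ∧ a.2 ≤ N ∧ t < av f a.1 a.2}
  obtain ⟨u, huT, hdisj, hcov⟩ :=
    Vitali.exists_disjoint_subfamily_covering_enlargement_closedBall T
      (fun a => a.1) (fun a => a.2) N (fun a ha => ha.2.1) 4 (by norm_num)
  have hcount : u.Countable := by
    apply hdisj.countable_of_nonempty_interior
    intro a ha
    refine ⟨a.1, ?_⟩
    rw [mem_interior]
    exact ⟨Metric.ball a.1 a.2, Metric.ball_subset_closedBall, Metric.isOpen_ball,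
      Metric.mem_ball_self (huT ha).1⟩
  have hsub : E N ⊆ ⋃ a ∈ u, Metric.closedBall a.1 (4 * a.2) := by
    rintro x ⟨c, r, hr, hN, hx, hA⟩
    obtain ⟨b, hb, hb2⟩ := hcov (c, r) ⟨hr, hN, hA⟩
    simp only [Set.mem_iUnion]
    exact ⟨b, hb, hb2 (Metric.ball_subset_closedBall hx)⟩
  calc t * μ (E N) ≤ t * ∑' a : u, μ (Metric.closedBall a.1.1 (4 * a.1.2)) := by
        gcongr
        exact (measure_mono hsub).trans (measure_biUnion_le μ hcount _)
    _ = ∑' a : u, t * μ (Metric.closedBall a.1.1 (4 * a.1.2)) := ENNReal.tsum_mul_left.symm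
    _ ≤ ∑' a : u, ENNReal.ofReal (4 ^ n) * K *
          ∫⁻ y in Metric.closedBall a.1.1 a.1.2, f y * w y := by
        refine ENNReal.tsum_le_tsum fun a => ?_
        rw [hμ, withDensity_apply _ Metric.isClosed_closedBall.measurableSet]
        exact weak_ball hw hwm hf (huT a.2).1 (huT a.2).2.2
    _ = ENNReal.ofReal (4 ^ n) * K * ∑' a : u,
          ∫⁻ y in Metric.closedBall a.1.1 a.1.2, f y * w y := ENNReal.tsum_mul_left
    _ = ENNReal.ofReal (4 ^ n) * K *
          ∫⁻ y in ⋃ a ∈ u, Metric.closedBall a.1 a.2, f y * w y := by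
        rw [lintegral_biUnion hcount (fun a _ => Metric.isClosed_closedBall.measurableSet) hdisj]
    _ ≤ _ := by
        gcongr
        exact Measure.restrict_le_self

/-- layer cake -/
lemma lint_rpow_Ioo {q b : ℝ} (hq : 0 < q) (hb : 0 ≤ b) :
    ∫⁻ t in Set.Ioo (0:ℝ) b, ENNReal.ofReal (t ^ (q - 1)) = ENNReal.ofReal (b ^ q / q) := by
  rw [restrict_Ioo_eq_restrict_Ioc]
  have h1 : IntervalIntegrable (fun t : ℝ => t ^ (q - 1)) volume 0 b :=
    intervalIntegral.intervalIntegrable_rpow' (by linarith)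
  rw [← ofReal_integral_eq_lintegral_ofReal]
  · rw [← intervalIntegral.integral_of_le hb, integral_rpow (Or.inl (by linarith))]
    simp [Real.zero_rpow hq.ne']
  · exact (intervalIntegrable_iff_integrableOn_Ioc_of_le hb).mp h1
  · rw [EventuallyLE, ae_restrict_iff' measurableSet_Ioc]
    exact Eventually.of_forall fun t ht => Real.rpow_nonneg ht.1.le _

lemma layer_pt {q : ℝ} (hq : 0 < q) (a : ℝ≥0∞) :
    ∫⁻ t in Set.Ioi (0:ℝ), ENNReal.ofReal (t ^ (q - 1)) *
      (if ENNReal.ofReal t < a then 1 else 0) = a ^ q * (ENNReal.ofReal q)⁻¹ := by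
  have key : ∀ b : ℝ, 0 ≤ b → (∫⁻ t in Set.Ioi (0:ℝ), ENNReal.ofReal (t ^ (q - 1)) *
      (if ENNReal.ofReal t < ENNReal.ofReal b then 1 else 0)) =
        ENNReal.ofReal b ^ q * (ENNReal.ofReal q)⁻¹ := by
    intro b hb
    have : ∀ t : ℝ, (Set.Ioi (0:ℝ)).indicator (fun t => ENNReal.ofReal (t ^ (q - 1)) *
      (if ENNReal.ofReal t < ENNReal.ofReal b then 1 else 0)) t =
       (Set.Ioo (0:ℝ) b).indicator (fun t => ENNReal.ofReal (t ^ (q - 1))) t := by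
      intro t
      by_cases h0 : 0 < t
      · by_cases hb' : t < b
        · have : ENNReal.ofReal t < ENNReal.ofReal b :=
            (ENNReal.ofReal_lt_ofReal_iff (h0.trans hb')).mpr hb'
          simp [Set.indicator, h0, hb', this]
        · have : ¬ ENNReal.ofReal t < ENNReal.ofReal b := by
            rw [not_lt] at hb' ⊢
            exact ENNReal.ofReal_le_ofReal hb'
          simp only [Set.indicator, Set.mem_Ioi, h0, Set.mem_Ioo, hb', this]
          simp
      · simp [Set.indicator, h0]
    rw [← lintegral_indicator measurableSet_Ioi]
    simp_rw [this]
    rw [lintegral_indicator measurableSet_Ioo, lint_rpow_Ioo hq hb,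
      ENNReal.ofReal_div_of_pos hq, ENNReal.ofReal_rpow_of_nonneg hb hq.le, div_eq_mul_inv]
  by_cases ha : a = ∞
  · subst ha
    rw [ENNReal.top_rpow_of_pos hq, ENNReal.top_mul (by simp)]
    rw [eq_top_iff]
    have hlim : Tendsto (fun N : ℕ => (ENNReal.ofReal (N : ℝ)) ^ q * (ENNReal.ofReal q)⁻¹) atTop
        (𝓝 (∞ ^ q * (ENNReal.ofReal q)⁻¹)) := by
      apply ENNReal.Tendsto.mul_const _ (Or.inl (by simp [hq]))
      apply Tendsto.ennrpow_const
      simpa using ENNReal.tendsto_nat_nhds_top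
    rw [ENNReal.top_rpow_of_pos hq, ENNReal.top_mul (by simp)] at hlim
    refine le_of_tendsto' hlim fun N => ?_
    rw [← key N (by positivity)]
    apply lintegral_mono
    intro t
    simp only
    gcongr
    split_ifs with h1 h2 h2 <;> simp_all
  · rw [← ENNReal.ofReal_toReal ha]
    exact key _ ENNReal.toReal_nonneg

lemma layer_cake {n : ℕ} {q : ℝ} (hq : 0 < q) {F : (Fin n → ℝ) → ℝ≥0∞} (hF : Measurable F)
    (μ : Measure (Fin n → ℝ)) [SFinite μ] :
    ∫⁻ x, F x ^ q ∂μ = ENNReal.ofReal q *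
      ∫⁻ t in Set.Ioi (0:ℝ), ENNReal.ofReal (t ^ (q - 1)) * μ {x | ENNReal.ofReal t < F x} := by
  have hq0 : ENNReal.ofReal q ≠ 0 := by simpa using hq
  have h1 : ∀ x, F x ^ q = ENNReal.ofReal q * ∫⁻ t in Set.Ioi (0:ℝ), ENNReal.ofReal (t ^ (q - 1)) *
      (if ENNReal.ofReal t < F x then 1 else 0) := by
    intro x
    rw [layer_pt hq, mul_comm (F x ^ q), ← mul_assoc,
      ENNReal.mul_inv_cancel hq0 ENNReal.ofReal_ne_top, one_mul]
  have hmeas : Measurable (fun z : (Fin n → ℝ) × ℝ => ENNReal.ofReal (z.2 ^ (q - 1)) *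
      (if ENNReal.ofReal z.2 < F z.1 then (1:ℝ≥0∞) else 0)) := by
    apply Measurable.mul
    · exact (measurable_snd.pow_const _).ennreal_ofReal
    · apply Measurable.ite _ measurable_const measurable_const
      exact measurableSet_lt measurable_snd.ennreal_ofReal (hF.comp measurable_fst)
  simp_rw [h1]
  rw [lintegral_const_mul _ hmeas.lintegral_prod_right']
  congr 1
  rw [lintegral_lintegral_swap hmeas.aemeasurable]
  apply lintegral_congr
  intro t
  have hm : MeasurableSet {x | ENNReal.ofReal t < F x} := measurableSet_lt measurable_const hF
  simp only
  rw [lintegral_const_mul]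
  · congr 1
    rw [← lintegral_indicator_one hm]
    simp [Set.indicator]
  · exact Measurable.ite hm measurable_const measurable_const

end BBMAux

namespace BBMAux

/-- constant of the strong type inequality -/
def SC (n : ℕ) (q : ℝ) (K : ℝ≥0∞) : ℝ≥0∞ :=
  ENNReal.ofReal q * (2 * (ENNReal.ofReal (4 ^ n) * K)) * (2 ^ (q - 1) * (ENNReal.ofReal (q - 1))⁻¹)

lemma SC_ne_top {n : ℕ} {q : ℝ} (hq : 1 < q) {K : ℝ≥0∞} (hK : K ≠ ∞) : SC n q K ≠ ∞ := by
  unfold SC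
  have h1 : (ENNReal.ofReal (q - 1))⁻¹ ≠ ∞ := by simpa using hq
  have h2 : (2:ℝ≥0∞) ^ (q - 1) ≠ ∞ := ENNReal.rpow_ne_top_of_nonneg (by linarith) (by simp)
  finiteness

lemma weak_cut {n : ℕ} {K : ℝ≥0∞} {w f : (Fin n → ℝ) → ℝ≥0∞} (hw : A1 K w)
    (hwm : Measurable w) (hf : Measurable f) {t : ℝ} (ht : 0 < t) :
    volume.withDensity w {x | ENNReal.ofReal t < mx f x} ≤ (ENNReal.ofReal t)⁻¹ *
      (2 * (ENNReal.ofReal (4 ^ n) * K) * ∫⁻ y, f y * w y *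
        (if ENNReal.ofReal t < 2 * f y then 1 else 0)) := by
  have ht0 : ENNReal.ofReal t ≠ 0 := by simpa using ht
  have hm : MeasurableSet {y | ENNReal.ofReal t < 2 * f y} :=
    measurableSet_lt measurable_const (hf.const_mul 2)
  let f1 : (Fin n → ℝ) → ℝ≥0∞ := fun y => f y * (if ENNReal.ofReal t < 2 * f y then 1 else 0)
  have hf1 : Measurable f1 := hf.mul (Measurable.ite hm measurable_const measurable_const)
  have hle : ∀ y, f y ≤ f1 y + ENNReal.ofReal t / 2 := by
    intro y
    by_cases h : ENNReal.ofReal t < 2 * f y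
    · simp [f1, h]
    · simp only [f1, h, if_false, mul_zero, zero_add]
      rw [ENNReal.le_div_iff_mul_le (by simp) (by simp), mul_comm]
      exact not_lt.mp h
  have hsub : {x | ENNReal.ofReal t < mx f x} ⊆ {x | ENNReal.ofReal t / 2 < mx f1 x} := by
    intro x hx
    have h1 : mx f x ≤ mx f1 x + ENNReal.ofReal t / 2 :=
      (mx_mono hle x).trans ((mx_add_le hf1 x).trans
        (add_le_add le_rfl (mx_le_of_le (fun _ => le_rfl) x)))
    simp only [Set.mem_ofPred_eq] at hx ⊢
    by_contra hcon
    rw [not_lt] at hcon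
    have := h1.trans (add_le_add hcon le_rfl)
    rw [ENNReal.add_halves] at this
    exact absurd this (not_le.mpr hx)
  have h2 := weak_type hw hwm hf1 (ENNReal.ofReal t / 2)
  have h3 : ∫⁻ y, f1 y * w y = ∫⁻ y, f y * w y *
        (if ENNReal.ofReal t < 2 * f y then 1 else 0) := by
    congr 1; ext y; simp only [f1]; ring
  rw [h3] at h2
  set S := ∫⁻ y, f y * w y * (if ENNReal.ofReal t < 2 * f y then 1 else 0)
  calc volume.withDensity w {x | ENNReal.ofReal t < mx f x}
      ≤ volume.withDensity w {x | ENNReal.ofReal t / 2 < mx f1 x} := measure_mono hsub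
    _ = (ENNReal.ofReal t)⁻¹ * (2 * (ENNReal.ofReal t / 2 *
        volume.withDensity w {x | ENNReal.ofReal t / 2 < mx f1 x})) := by
        rw [← mul_assoc 2, ENNReal.mul_div_cancel (by simp) (by simp), ← mul_assoc,
          ENNReal.inv_mul_cancel ht0 ENNReal.ofReal_ne_top, one_mul]
    _ ≤ (ENNReal.ofReal t)⁻¹ * (2 * (ENNReal.ofReal (4 ^ n) * K * S)) := by gcongr
    _ = _ := by ring

lemma strong_type {n : ℕ} {K : ℝ≥0∞} {w f : (Fin n → ℝ) → ℝ≥0∞} (hw : A1 K w)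
    (hwm : Measurable w) (hf : Measurable f) {q : ℝ} (hq : 1 < q) :
    ∫⁻ x, mx f x ^ q * w x ≤ SC n q K * ∫⁻ x, f x ^ q * w x := by
  have e1 : ∫⁻ x, mx f x ^ q * w x = ∫⁻ x, mx f x ^ q ∂(volume.withDensity w) := by
    rw [lintegral_withDensity_eq_lintegral_mul _ hwm ((measurable_mx f).pow_const q)]
    congr 1; ext x; simp [mul_comm]
  have hq1 : 0 < q - 1 := by linarith
  set D := 2 * (ENNReal.ofReal (4 ^ n) * K)
  have hmeas : Measurable (fun z : ℝ × (Fin n → ℝ) => ENNReal.ofReal (z.1 ^ (q - 1 - 1)) *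
      (f z.2 * w z.2 * (if ENNReal.ofReal z.1 < 2 * f z.2 then (1:ℝ≥0∞) else 0))) := by
    apply Measurable.mul
    · exact (measurable_fst.pow_const _).ennreal_ofReal
    · apply Measurable.mul
      · fun_prop
      · apply Measurable.ite _ measurable_const measurable_const
        exact measurableSet_lt measurable_fst.ennreal_ofReal
          ((hf.comp measurable_snd).const_mul 2)
  rw [e1, layer_cake (by linarith) (measurable_mx f)]
  calc ENNReal.ofReal q * ∫⁻ t in Set.Ioi (0:ℝ), ENNReal.ofReal (t ^ (q - 1)) *
        volume.withDensity w {x | ENNReal.ofReal t < mx f x}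
      ≤ ENNReal.ofReal q * ∫⁻ t in Set.Ioi (0:ℝ), D * ∫⁻ y, ENNReal.ofReal (t ^ (q - 1 - 1)) *
          (f y * w y * (if ENNReal.ofReal t < 2 * f y then 1 else 0)) := by
        gcongr 1
        apply setLIntegral_mono' measurableSet_Ioi
        intro t ht
        have ht' : 0 < t := ht
        refine (mul_le_mul_right (weak_cut hw hwm hf ht') _).trans ?_
        have e2 : ENNReal.ofReal (t ^ (q - 1)) * (ENNReal.ofReal t)⁻¹ =
            ENNReal.ofReal (t ^ (q - 1 - 1)) := by
          rw [← ENNReal.ofReal_inv_of_pos ht', ← ENNReal.ofReal_mul (by positivity)]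
          congr 1
          rw [Real.rpow_sub_one ht'.ne' (q - 1)]; rfl
        rw [← mul_assoc, e2, lintegral_const_mul' _ _ ENNReal.ofReal_ne_top]
        apply le_of_eq; ring
    _ = ENNReal.ofReal q * (D * ∫⁻ t in Set.Ioi (0:ℝ), ∫⁻ y, ENNReal.ofReal (t ^ (q - 1 - 1)) *
          (f y * w y * (if ENNReal.ofReal t < 2 * f y then 1 else 0))) := by
        rw [lintegral_const_mul _ hmeas.lintegral_prod_right']
    _ = ENNReal.ofReal q * (D * ∫⁻ y, ∫⁻ t in Set.Ioi (0:ℝ), ENNReal.ofReal (t ^ (q - 1 - 1)) *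
          (f y * w y * (if ENNReal.ofReal t < 2 * f y then 1 else 0))) := by
        rw [lintegral_lintegral_swap hmeas.aemeasurable]
    _ = ENNReal.ofReal q * (D * ∫⁻ y, (2 ^ (q - 1) * (ENNReal.ofReal (q - 1))⁻¹) *
          (f y ^ q * w y)) := by
        congr 2
        apply lintegral_congr
        intro y
        have hm2 : Measurable (fun t : ℝ => ENNReal.ofReal (t ^ (q - 1 - 1)) *
            (if ENNReal.ofReal t < 2 * f y then (1:ℝ≥0∞) else 0)) := by
          apply Measurable.mul
          · exact (measurable_id.pow_const _).ennreal_ofReal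
          · apply Measurable.ite _ measurable_const measurable_const
            exact measurableSet_lt measurable_id.ennreal_ofReal measurable_const
        calc ∫⁻ t in Set.Ioi (0:ℝ), ENNReal.ofReal (t ^ (q - 1 - 1)) *
              (f y * w y * (if ENNReal.ofReal t < 2 * f y then 1 else 0))
            = ∫⁻ t in Set.Ioi (0:ℝ), (f y * w y) * (ENNReal.ofReal (t ^ (q - 1 - 1)) *
              (if ENNReal.ofReal t < 2 * f y then 1 else 0)) := by
              congr 1; ext t; ring
          _ = (f y * w y) * ((2 * f y) ^ (q - 1) * (ENNReal.ofReal (q - 1))⁻¹) := by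
              rw [lintegral_const_mul _ hm2, layer_pt hq1]
          _ = _ := by
              rw [ENNReal.mul_rpow_of_nonneg _ _ hq1.le]
              have : f y ^ q = f y * f y ^ (q - 1) := by
                conv_lhs => rw [show q = 1 + (q - 1) by ring,
                  ENNReal.rpow_add_of_nonneg _ _ (by norm_num) hq1.le, ENNReal.rpow_one]
              rw [this]; ring
    _ = _ := by
        rw [lintegral_const_mul _ (by fun_prop)]
        unfold SC; ring

lemma lint_rpow_Ioi {d b : ℝ} (hd : d < 1) (hb : 0 < b) :
    ∫⁻ t in Set.Ioi b, ENNReal.ofReal (t ^ (d - 2)) = ENNReal.ofReal (b ^ (d - 1) / (1 - d)) := by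
  rw [← ofReal_integral_eq_lintegral_ofReal]
  · rw [integral_Ioi_rpow_of_lt (by linarith) hb]
    congr 1
    rw [show d - 2 + 1 = d - 1 by ring, ← neg_div_neg_eq]
    congr 1 <;> ring
  · exact integrableOn_Ioi_rpow_of_lt (by linarith) hb
  · rw [EventuallyLE, ae_restrict_iff' measurableSet_Ioi]
    exact Eventually.of_forall fun t ht => Real.rpow_nonneg (hb.trans ht).le _

lemma kolmogorov {n : ℕ} {d : ℝ} (hd0 : 0 < d) (hd1 : d < 1) {F : (Fin n → ℝ) → ℝ≥0∞}
    (hF : Measurable F) (μ : Measure (Fin n → ℝ)) [IsFiniteMeasure μ] (hμ : μ Set.univ ≠ 0)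
    {A : ℝ≥0∞} (hA : ∀ t : ℝ, 0 < t → ENNReal.ofReal t * μ {x | ENNReal.ofReal t < F x} ≤
      A * μ Set.univ) :
    ∫⁻ x, F x ^ d ∂μ ≤ ENNReal.ofReal (1 / (1 - d)) * A ^ d * μ Set.univ := by
  set m := μ Set.univ
  have h1d : 0 < 1 - d := by linarith
  by_cases hAt : A = ∞
  · subst hAt
    rw [ENNReal.top_rpow_of_pos hd0, ENNReal.mul_top (by simpa using hd1), ENNReal.top_mul hμ]
    exact le_top
  obtain ⟨b, hb, rfl⟩ : ∃ b : ℝ, 0 ≤ b ∧ A = ENNReal.ofReal b :=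
    ⟨A.toReal, ENNReal.toReal_nonneg, (ENNReal.ofReal_toReal hAt).symm⟩
  rw [layer_cake hd0 hF]
  have hsplit : Set.Ioi (0:ℝ) = Set.Ioc 0 b ∪ Set.Ioi b := (Set.Ioc_union_Ioi_eq_Ioi hb).symm
  have hfirst : ∫⁻ t in Set.Ioc 0 b, ENNReal.ofReal (t ^ (d - 1)) * μ {x | ENNReal.ofReal t < F x}
      ≤ ENNReal.ofReal (b ^ d / d) * m := by
    rw [← lint_rpow_Ioo hd0 hb, restrict_Ioo_eq_restrict_Ioc,
      ← lintegral_mul_const' _ _ (measure_ne_top μ _)]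
    apply lintegral_mono
    intro t
    exact mul_le_mul_right (measure_mono (Set.subset_univ _)) _
  have hpt : ∀ t : ℝ, 0 < t → ENNReal.ofReal (t ^ (d - 1)) * μ {x | ENNReal.ofReal t < F x} ≤
      ENNReal.ofReal (t ^ (d - 2)) * (ENNReal.ofReal b * m) := by
    intro t ht
    have e : ENNReal.ofReal (t ^ (d - 1)) = ENNReal.ofReal (t ^ (d - 2)) * ENNReal.ofReal t := by
      rw [← ENNReal.ofReal_mul (by positivity), show d - 1 = d - 2 + 1 by ring,
        Real.rpow_add_one ht.ne']
    rw [e, mul_assoc]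
    exact mul_le_mul_right (hA t ht) _
  have hsecond : ∫⁻ t in Set.Ioi b, ENNReal.ofReal (t ^ (d - 1)) * μ {x | ENNReal.ofReal t < F x}
      ≤ ENNReal.ofReal (b ^ d / (1 - d)) * m := by
    have hle : ∫⁻ t in Set.Ioi b, ENNReal.ofReal (t ^ (d - 1)) * μ {x | ENNReal.ofReal t < F x} ≤
       ∫⁻ t in Set.Ioi b, ENNReal.ofReal (t ^ (d - 2)) * (ENNReal.ofReal b * m) :=
      setLIntegral_mono' measurableSet_Ioi fun t ht => hpt t (lt_of_le_of_lt hb ht)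
    refine hle.trans ?_
    rw [lintegral_mul_const' _ _ (by finiteness)]
    rcases hb.eq_or_lt with h0 | h0
    · simp [← h0]
    · rw [lint_rpow_Ioi hd1 h0, ← mul_assoc, ← ENNReal.ofReal_mul (by positivity)]
      apply le_of_eq
      congr 2
      rw [Real.rpow_sub_one h0.ne']; field_simp
  calc ENNReal.ofReal d * ∫⁻ t in Set.Ioi (0:ℝ), ENNReal.ofReal (t ^ (d - 1)) *
        μ {x | ENNReal.ofReal t < F x}
      ≤ ENNReal.ofReal d * (ENNReal.ofReal (b ^ d / d) * m + ENNReal.ofReal (b ^ d / (1 - d)) * m) := by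
        gcongr
        rw [hsplit]
        exact (lintegral_union_le _ _ _).trans (add_le_add hfirst hsecond)
    _ = _ := by
        rw [← add_mul, ← mul_assoc, ENNReal.ofReal_rpow_of_nonneg hb hd0.le,
          ← ENNReal.ofReal_add (by positivity) (by positivity), ← ENNReal.ofReal_mul hd0.le,
          ← ENNReal.ofReal_mul (by positivity)]
        congr 2
        field_simp
        ring

end BBMAux

namespace BBMAux

/-- Coifman-Rochberg constant -/
def CR (n : ℕ) (d : ℝ) : ℝ≥0∞ :=
  ENNReal.ofReal (1 / (1 - d)) * (ENNReal.ofReal (4 ^ n) * ENNReal.ofReal (3 ^ n)) ^ d +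
    ENNReal.ofReal (3 ^ n) ^ d

lemma CR_ne_top {n : ℕ} {d : ℝ} (hd : 0 < d) : CR n d ≠ ∞ := by
  unfold CR
  have h1 : (ENNReal.ofReal (4 ^ n) * ENNReal.ofReal (3 ^ n)) ^ d ≠ ∞ :=
    ENNReal.rpow_ne_top_of_nonneg hd.le (by finiteness)
  have h2 : ENNReal.ofReal (3 ^ n) ^ d ≠ ∞ :=
    ENNReal.rpow_ne_top_of_nonneg hd.le (by finiteness)
  finiteness

lemma CR_far {n : ℕ} (f : (Fin n → ℝ) → ℝ≥0∞) {c x y : Fin n → ℝ} {r : ℝ} (hr : 0 < r)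
    (hx : x ∈ Metric.closedBall c r) (hy : y ∈ Metric.closedBall c r) :
    mx ((Metric.closedBall c (3 * r))ᶜ.indicator f) y ≤ ENNReal.ofReal (3 ^ n) * mx f x := by
  refine mx_le fun c' r' hr' hy' => ?_
  rw [Metric.mem_closedBall] at hx hy
  rw [Metric.mem_ball] at hy'
  by_cases h : ∃ z ∈ Metric.closedBall c' r', z ∉ Metric.closedBall c (3 * r)
  · obtain ⟨z, hz, hzc⟩ := h
    rw [Metric.mem_closedBall] at hz hzc
    have hrr : r < r' := by
      have h1 := dist_triangle z c' y
      have h2 := dist_triangle z y c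
      rw [dist_comm c' y] at h1
      linarith
    have hxb : x ∈ Metric.ball c' (3 * r') := by
      rw [Metric.mem_ball]
      have h1 := dist_triangle x c y
      have h2 := dist_triangle x y c'
      rw [dist_comm c y] at h1
      linarith
    refine (av_mono (Set.indicator_le_self' (fun _ _ => zero_le)) c' r').trans ?_
    refine (av_le_scale f (t := 3) (by norm_num)
      (Metric.closedBall_subset_closedBall (by linarith))).trans ?_
    gcongr
    exact av_le_mx f (by positivity) hxb
  · push Not at h
    refine (av_le_of_le hr' (A := 0) fun z hz => ?_).trans zero_le
    simp [h z hz]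

lemma CR_A1 {n : ℕ} {d : ℝ} (hd0 : 0 < d) (hd1 : d < 1) {f : (Fin n → ℝ) → ℝ≥0∞}
    (hf : Measurable f) : A1 (CR n d) (fun x => mx f x ^ d) := by
  intro c r hr x hx
  have hBm : MeasurableSet (Metric.closedBall c (3 * r)) := Metric.isClosed_closedBall.measurableSet
  set f1 := (Metric.closedBall c (3 * r)).indicator f with hf1
  set f2 := (Metric.closedBall c (3 * r))ᶜ.indicator f with hf2
  have hf1m : Measurable f1 := hf.indicator hBm
  have hsum : ∀ y, f y = f1 y + f2 y := by
    intro y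
    simp only [hf1, hf2]
    rw [Set.indicator_self_add_compl_apply]
  have hxb : x ∈ Metric.ball c (3 * r) := by
    rw [Metric.mem_closedBall] at hx
    rw [Metric.mem_ball]; linarith
  set B := Metric.closedBall c r
  have hvB : volume B = cv n r := vol_cb c hr.le
  have : IsFiniteMeasure (volume.restrict B) :=
    ⟨by rw [Measure.restrict_apply_univ, hvB]; exact cv_ne_top.lt_top⟩
  set A := (ENNReal.ofReal (4 ^ n) * ENNReal.ofReal (3 ^ n)) * mx f x with hAdef
  have hf1int : ∫⁻ y, f1 y ≤ ENNReal.ofReal (3 ^ n) * cv n r * mx f x := by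
    rw [hf1, lintegral_indicator hBm]
    have h1 := av_le_mx f (by positivity : 0 < 3 * r) hxb
    unfold av at h1
    rw [mul_comm, ← div_eq_mul_inv, ENNReal.div_le_iff (cv_ne_zero (by positivity)) cv_ne_top,
      cv_mul (by norm_num)] at h1
    rw [mul_comm (ENNReal.ofReal (3 ^ n) * cv n r)]
    exact h1
  have hkol : ∫⁻ y in B, mx f1 y ^ d ≤ ENNReal.ofReal (1 / (1 - d)) * A ^ d * cv n r := by
    have := kolmogorov hd0 hd1 (measurable_mx f1) (volume.restrict B) (A := A)
      (by rw [Measure.restrict_apply_univ, hvB]; exact cv_ne_zero hr) ?_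
    · rwa [Measure.restrict_apply_univ, hvB] at this
    · intro t ht
      rw [Measure.restrict_apply_univ, hvB]
      have h2 := weak_type (A1_one (n := n)) measurable_const hf1m (ENNReal.ofReal t)
      simp only [withDensity_const, one_smul, mul_one] at h2
      calc ENNReal.ofReal t * (volume.restrict B) {x | ENNReal.ofReal t < mx f1 x}
          ≤ ENNReal.ofReal t * volume {x | ENNReal.ofReal t < mx f1 x} :=
            mul_le_mul_right (Measure.restrict_apply_le _ _) _
        _ ≤ ENNReal.ofReal (4 ^ n) * ∫⁻ y, f1 y := h2
        _ ≤ ENNReal.ofReal (4 ^ n) * (ENNReal.ofReal (3 ^ n) * cv n r * mx f x) := by gcongr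
        _ = _ := by rw [hAdef]; ring
  unfold av
  rw [mul_comm, ← div_eq_mul_inv, ENNReal.div_le_iff (cv_ne_zero hr) cv_ne_top]
  calc ∫⁻ y in B, mx f y ^ d
      ≤ ∫⁻ y in B, (mx f1 y ^ d + (ENNReal.ofReal (3 ^ n) * mx f x) ^ d) := by
        apply setLIntegral_mono' Metric.isClosed_closedBall.measurableSet
        intro y hy
        have h3 : mx f y ≤ mx f1 y + ENNReal.ofReal (3 ^ n) * mx f x := by
          refine (mx_mono (fun y => (hsum y).le) y).trans ((mx_add_le hf1m y).trans ?_)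
          exact add_le_add le_rfl (CR_far f hr hx hy)
        exact (ENNReal.rpow_le_rpow h3 hd0.le).trans
          (ENNReal.rpow_add_le_add_rpow _ _ hd0.le hd1.le)
    _ = (∫⁻ y in B, mx f1 y ^ d) + (ENNReal.ofReal (3 ^ n) * mx f x) ^ d * cv n r := by
        rw [lintegral_add_left ((measurable_mx f1).pow_const d), setLIntegral_const, hvB]
    _ ≤ ENNReal.ofReal (1 / (1 - d)) * A ^ d * cv n r +
          (ENNReal.ofReal (3 ^ n) * mx f x) ^ d * cv n r := by gcongr
    _ = _ := by
        rw [hAdef, ENNReal.mul_rpow_of_nonneg _ (mx f x) hd0.le,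
          ENNReal.mul_rpow_of_nonneg _ (mx f x) hd0.le]
        unfold CR
        ring

/-- decay of the maximal function off the support -/
lemma mx_decay {n : ℕ} {f : (Fin n → ℝ) → ℝ≥0∞} {c x : Fin n → ℝ} {r s : ℝ} (hr : 0 < r)
    (hsupp : ∀ y, y ∉ Metric.closedBall c r → f y = 0) (hs : 2 * r ≤ s) (hx : s ≤ dist x c) :
    mx f x ≤ (cv n (s / 4))⁻¹ * ∫⁻ y, f y := by
  refine mx_le fun c' r' hr' hx' => ?_
  rw [Metric.mem_ball] at hx'
  by_cases h : ∃ z ∈ Metric.closedBall c' r', z ∈ Metric.closedBall c r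
  · obtain ⟨z, hz, hzc⟩ := h
    rw [Metric.mem_closedBall] at hz hzc
    have h1 := dist_triangle x z c
    have h2 := dist_triangle x c' z
    rw [dist_comm c' z] at h2
    unfold av
    gcongr
    · exact cv_mono (by linarith) (by linarith)
    · exact Measure.restrict_le_self
  · push Not at h
    refine (av_le_of_le hr' (A := 0) fun z hz => ?_).trans zero_le
    exact (hsupp z (h z hz)).le

/-- Lebesgue differentiation -/
lemma le_mx_aux {n : ℕ} {f : (Fin n → ℝ) → ℝ≥0∞} (hf : Measurable f) (hfi : ∫⁻ y, f y ≠ ∞) :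
    ∀ᵐ x, f x ≤ mx f x := by
  have h := VitaliFamily.ae_tendsto_lintegral_div
    (IsUnifLocDoublingMeasure.vitaliFamily (volume : Measure (Fin n → ℝ)) 1) hf.aemeasurable hfi
  filter_upwards [h] with x hx
  have hd : Tendsto (fun j : ℕ => (1:ℝ) / ((j:ℝ) + 1)) atTop (𝓝[>] 0) := by
    rw [tendsto_nhdsWithin_iff]
    exact ⟨tendsto_one_div_add_atTop_nhds_zero_nat,
      Eventually.of_forall fun j => by simp only [Set.mem_Ioi]; positivity⟩
  have h2 := IsUnifLocDoublingMeasure.tendsto_closedBall_filterAt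
    (volume : Measure (Fin n → ℝ)) (K := 1) (x := x) (fun _ : ℕ => x)
      (fun j => (1:ℝ) / ((j:ℝ) + 1)) hd
      (Eventually.of_forall fun j => Metric.mem_closedBall_self (by positivity))
  refine le_of_tendsto' (hx.comp h2) fun j => ?_
  have hj : (0:ℝ) < 1 / ((j:ℝ) + 1) := by positivity
  have := av_le_mx f hj (Metric.mem_ball_self (x := x) hj)
  unfold av at this
  simp only [Function.comp]
  rw [vol_cb x hj.le, div_eq_mul_inv, mul_comm]
  exact this

lemma le_mx {n : ℕ} {f : (Fin n → ℝ) → ℝ≥0∞} (hf : Measurable f) : ∀ᵐ x, f x ≤ mx f x := by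
  let g : ℕ → (Fin n → ℝ) → ℝ≥0∞ := fun k =>
    (Metric.closedBall (0 : Fin n → ℝ) k).indicator fun x => min (f x) k
  have hgm : ∀ k, Measurable (g k) := fun k =>
    (hf.min measurable_const).indicator Metric.isClosed_closedBall.measurableSet
  have hgi : ∀ k, ∫⁻ y, g k y ≠ ∞ := by
    intro k
    rw [lintegral_indicator Metric.isClosed_closedBall.measurableSet]
    have : ∫⁻ y in Metric.closedBall (0 : Fin n → ℝ) k, min (f y) k ≤
        ∫⁻ y in Metric.closedBall (0 : Fin n → ℝ) k, (k : ℝ≥0∞) :=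
      lintegral_mono fun y => min_le_right _ _
    refine ne_top_of_le_ne_top ?_ this
    rw [setLIntegral_const, vol_cb _ (by positivity)]
    exact ENNReal.mul_ne_top (by simp) cv_ne_top
  have h := ae_all_iff.mpr fun k => le_mx_aux (hgm k) (hgi k)
  filter_upwards [h] with x hx
  refine le_of_forall_lt fun a ha => ?_
  obtain ⟨k1, hk1⟩ := exists_nat_ge (dist x 0)
  obtain ⟨k2, hk2⟩ := ENNReal.exists_nat_gt (ne_top_of_lt ha)
  have hmem : x ∈ Metric.closedBall (0 : Fin n → ℝ) ((max k1 k2 : ℕ) : ℝ) := by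
    rw [Metric.mem_closedBall]
    exact hk1.trans (by exact_mod_cast le_max_left _ _)
  have h1 : a < g (max k1 k2) x := by
    simp only [g, Set.indicator_of_mem hmem]
    refine lt_min ha (hk2.trans_le ?_)
    exact_mod_cast le_max_right _ _
  have h2 : ∀ y, g (max k1 k2) y ≤ f y := by
    intro y
    simp only [g]
    exact (Set.indicator_le_self' (fun _ _ => zero_le) y).trans (min_le_left _ _)
  exact h1.trans_le ((hx _).trans (mx_mono h2 x))

lemma mx_pos {n : ℕ} {f : (Fin n → ℝ) → ℝ≥0∞} (hfi : ∫⁻ y, f y ≠ 0)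
    (x : Fin n → ℝ) : 0 < mx f x := by
  rw [pos_iff_ne_zero]
  intro h0
  apply hfi
  have h1 : ∀ k : ℕ, ∫⁻ y in Metric.closedBall x ((k:ℝ) + 1), f y = 0 := by
    intro k
    have hk : (0:ℝ) < k + 1 := by positivity
    have := av_le_mx f hk (Metric.mem_ball_self (x := x) hk)
    rw [h0, nonpos_iff_eq_zero] at this
    unfold av at this
    rw [mul_eq_zero] at this
    rcases this with h | h
    · exact absurd h (ENNReal.inv_ne_zero.mpr cv_ne_top)
    · exact h
  have h2 : (⋃ k : ℕ, Metric.closedBall x ((k:ℝ) + 1)) = Set.univ := by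
    rw [Set.eq_univ_iff_forall]
    intro y
    obtain ⟨k, hk⟩ := exists_nat_ge (dist y x)
    rw [Set.mem_iUnion]
    exact ⟨k, by rw [Metric.mem_closedBall]; linarith⟩
  have h3 := lintegral_iUnion_le (μ := volume) (fun k : ℕ => Metric.closedBall x ((k:ℝ) + 1)) f
  rw [h2, Measure.restrict_univ] at h3
  simpa [h1] using h3

end BBMAux

namespace BBMAux

def Ap {n : ℕ} (p : ℝ) (K : ℝ≥0∞) (W : (Fin n → ℝ) → ℝ≥0∞) : Prop :=
  ∀ c r, 0 < r → av W c r * (av (fun y => W y ^ (-(1 / (p - 1)))) c r) ^ (p - 1) ≤ K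

def PF {n : ℕ} (W : (Fin n → ℝ) → ℝ≥0∞) : Prop := ∀ᵐ x, 0 < W x ∧ W x < ∞

/-- extrapolation family on `Fin n → ℝ` -/
def Fam {n : ℕ} (p : ℝ) (Φ : ℝ≥0∞ → ℝ≥0∞) (F G : (Fin n → ℝ) → ℝ≥0∞) : Prop :=
  ∀ W : (Fin n → ℝ) → ℝ≥0∞, Measurable W → PF W → ∀ K, K ≠ ∞ → Ap p K W →
    ∫⁻ x, F x ^ p * W x ≤ Φ K * ∫⁻ x, G x ^ p * W x

lemma av_mono_ae {n : ℕ} {f g : (Fin n → ℝ) → ℝ≥0∞} {c : Fin n → ℝ} {r : ℝ}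
    (h : ∀ᵐ x, x ∈ Metric.closedBall c r → f x ≤ g x) : av f c r ≤ av g c r := by
  unfold av
  gcongr 1
  exact setLIntegral_mono_ae' Metric.isClosed_closedBall.measurableSet h

lemma av_const_mul {n : ℕ} {f : (Fin n → ℝ) → ℝ≥0∞} (hf : Measurable f) {c : Fin n → ℝ} {r : ℝ}
    (a : ℝ≥0∞) : av (fun x => a * f x) c r = a * av f c r := by
  unfold av
  rw [lintegral_const_mul _ hf]; ring

lemma av_pos {n : ℕ} {f : (Fin n → ℝ) → ℝ≥0∞} (hf : Measurable f) (hp : PF f)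
    {c : Fin n → ℝ} {r : ℝ} (hr : 0 < r) : av f c r ≠ 0 := by
  unfold av
  refine mul_ne_zero (ENNReal.inv_ne_zero.mpr cv_ne_top) ?_
  intro h
  rw [lintegral_eq_zero_iff hf] at h
  have h2 : ∀ᵐ x ∂(volume.restrict (Metric.closedBall c r)), False := by
    filter_upwards [h, ae_restrict_of_ae hp] with x h1 h2
    simp only [Pi.zero_apply] at h1
    rw [h1] at h2
    exact absurd h2.1 (lt_irrefl _)
  rw [eventually_false_iff_eq_bot, ae_eq_bot, Measure.restrict_eq_zero, vol_cb c hr.le] at h2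
  exact cv_ne_zero hr h2

lemma av_lt_top {n : ℕ} {f : (Fin n → ℝ) → ℝ≥0∞} {K : ℝ≥0∞} (hK : K ≠ ∞) (hA : A1 K f)
    (hp : PF f) {c : Fin n → ℝ} {r : ℝ} (hr : 0 < r) : av f c r ≠ ∞ := by
  intro h
  have h2 : ∀ᵐ x ∂(volume.restrict (Metric.closedBall c r)), False := by
    rw [ae_restrict_iff' Metric.isClosed_closedBall.measurableSet]
    filter_upwards [hp] with x hx hxm
    have := hA c r hr x hxm
    rw [h, top_le_iff] at this
    exact ENNReal.mul_ne_top hK hx.2.ne this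
  rw [eventually_false_iff_eq_bot, ae_eq_bot, Measure.restrict_eq_zero, vol_cb c hr.le] at h2
  exact cv_ne_zero hr h2

lemma A1_K_ne_zero {n : ℕ} {f : (Fin n → ℝ) → ℝ≥0∞} {K : ℝ≥0∞} (hf : Measurable f) (hA : A1 K f)
    (hp : PF f) : K ≠ 0 := by
  rintro rfl
  have := hA 0 1 one_pos 0 (Metric.mem_closedBall_self zero_le_one)
  rw [zero_mul, nonpos_iff_eq_zero] at this
  exact av_pos hf hp one_pos this

lemma Ap_of_A1 {n : ℕ} {p : ℝ} (hp : 1 < p) {u v : (Fin n → ℝ) → ℝ≥0∞} {K1 K2 : ℝ≥0∞}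
    (hu : Measurable u) (hv : Measurable v) (hup : PF u) (hvp : PF v) (hK1 : K1 ≠ ∞)
    (hK2 : K2 ≠ ∞) (huA : A1 K1 u) (hvA : A1 K2 v) :
    Ap p (K1 * K2 ^ (p - 1)) (fun x => u x * v x ^ (-(p - 1))) := by
  intro c r hr
  have hp1 : 0 < p - 1 := by linarith
  have hK10 := A1_K_ne_zero hu huA hup
  have hK20 := A1_K_ne_zero hv hvA hvp
  set U := av u c r with hU
  set V := av v c r with hV
  have hU0 : U ≠ 0 := av_pos hu hup hr
  have hV0 : V ≠ 0 := av_pos hv hvp hr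
  have hUt : U ≠ ∞ := av_lt_top hK1 huA hup hr
  have hVt : V ≠ ∞ := av_lt_top hK2 hvA hvp hr
  set X1 := ((V / K2) ^ (p - 1))⁻¹ with hX1
  set X2 := ((U / K1) ^ (1 / (p - 1)))⁻¹ with hX2
  have h1 : av (fun x => u x * v x ^ (-(p - 1))) c r ≤ X1 * U := by
    rw [hU, ← av_const_mul hu]
    apply av_mono_ae
    refine Eventually.of_forall fun x hx => ?_
    rw [mul_comm]
    gcongr
    rw [ENNReal.rpow_neg, hX1, ENNReal.inv_le_inv]
    refine ENNReal.rpow_le_rpow ?_ hp1.le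
    rw [ENNReal.div_le_iff hK20 hK2, mul_comm]
    exact hvA c r hr x hx
  have h2 : av (fun x => (u x * v x ^ (-(p - 1))) ^ (-(1 / (p - 1)))) c r ≤ X2 * V := by
    rw [hV, ← av_const_mul hv]
    apply av_mono_ae
    filter_upwards [hup, hvp] with x hux hvx hx
    have e1 : (u x * v x ^ (-(p - 1))) ^ (-(1 / (p - 1))) = (u x ^ (1 / (p - 1)))⁻¹ * v x := by
      rw [ENNReal.mul_rpow_of_ne_top hux.2.ne
        (ENNReal.rpow_ne_top_of_ne_zero hvx.1.ne' hvx.2.ne), ENNReal.rpow_neg, ← ENNReal.rpow_mul]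
      congr 1
      rw [show -(p - 1) * -(1 / (p - 1)) = 1 by field_simp, ENNReal.rpow_one]
    rw [e1]
    gcongr
    rw [hX2, ENNReal.inv_le_inv]
    refine ENNReal.rpow_le_rpow ?_ (by positivity)
    rw [ENNReal.div_le_iff hK10 hK1, mul_comm]
    exact huA c r hr x hx
  have e2 : (X2 * V) ^ (p - 1) = K1 / U * V ^ (p - 1) := by
    rw [ENNReal.mul_rpow_of_nonneg _ _ hp1.le, hX2, ENNReal.inv_rpow, ← ENNReal.rpow_mul,
      show 1 / (p - 1) * (p - 1) = 1 by field_simp, ENNReal.rpow_one,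
      ENNReal.inv_div (Or.inl hK1) (Or.inl hK10)]
  have e3 : X1 = K2 ^ (p - 1) / V ^ (p - 1) := by
    rw [hX1, ENNReal.div_rpow_of_nonneg _ _ hp1.le, ENNReal.inv_div]
    · left; exact ENNReal.rpow_ne_top_of_nonneg hp1.le hK2
    · left; exact (ENNReal.rpow_pos (pos_iff_ne_zero.mpr hK20) hK2).ne'
  have hVp0 : V ^ (p - 1) ≠ 0 := (ENNReal.rpow_pos (pos_iff_ne_zero.mpr hV0) hVt).ne'
  have hVpt : V ^ (p - 1) ≠ ∞ := ENNReal.rpow_ne_top_of_nonneg hp1.le hVt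
  calc _ ≤ (X1 * U) * (X2 * V) ^ (p - 1) := by
        gcongr
    _ = K1 * K2 ^ (p - 1) * (U * U⁻¹) * (V ^ (p - 1) * (V ^ (p - 1))⁻¹) := by
        rw [e2, e3, div_eq_mul_inv, div_eq_mul_inv]; ring
    _ = _ := by
        rw [ENNReal.mul_inv_cancel hU0 hUt, ENNReal.mul_inv_cancel hVp0 hVpt, mul_one, mul_one]
    _ ≤ _ := le_rfl

lemma PF_one {n : ℕ} : PF (n := n) (fun _ => 1) := Eventually.of_forall fun _ => by simp

lemma Fam_A1 {n : ℕ} {p : ℝ} (hp : 1 < p) {Φ : ℝ≥0∞ → ℝ≥0∞} {F G : (Fin n → ℝ) → ℝ≥0∞}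
    (hFG : Fam p Φ F G) {w : (Fin n → ℝ) → ℝ≥0∞} {K : ℝ≥0∞} (hw : Measurable w) (hwp : PF w)
    (hK : K ≠ ∞) (hA : A1 K w) : ∫⁻ x, F x ^ p * w x ≤ Φ K * ∫⁻ x, G x ^ p * w x := by
  refine hFG w hw hwp K hK ?_
  have := Ap_of_A1 hp hw measurable_const hwp PF_one hK ENNReal.one_ne_top hA A1_one
  simpa using this

/-- Extrapolation downwards -/
lemma extrap_down {n : ℕ} {p q : ℝ} (hq : 1 < q) (hqp : q < p) {Φ : ℝ≥0∞ → ℝ≥0∞}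
    {F G : (Fin n → ℝ) → ℝ≥0∞}
    (hF : Measurable F) (hG : Measurable G) (hFG : Fam p Φ F G)
    {w : (Fin n → ℝ) → ℝ≥0∞} {K : ℝ≥0∞} (hw : Measurable w) (hwp : PF w)
    (hK : K ≠ ∞) (hA : A1 K w) (hfin : ∫⁻ x, G x ^ q * w x ≠ ∞) :
    ∫⁻ x, F x ^ q * w x ≤ (Φ (K * CR n ((p - q) / (p - 1)) ^ (p - 1)) ^ (q / p) *
      SC n q K ^ (1 - q / p)) * ∫⁻ x, G x ^ q * w x := by
  have hp0 : 0 < p := by linarith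
  have hq0 : 0 < q := by linarith
  have hp1 : 0 < p - 1 := by linarith
  have hpq : 0 < p - q := by linarith
  set d := (p - q) / (p - 1) with hd
  have hd0 : 0 < d := by positivity
  have hd1 : d < 1 := by rw [hd, div_lt_one hp1]; linarith
  by_cases hG0 : ∫⁻ y, G y = 0
  · have h1 : ∫⁻ x, F x ^ p * 1 ≤ Φ 1 * ∫⁻ x, G x ^ p * 1 :=
      Fam_A1 (by linarith) hFG measurable_const PF_one ENNReal.one_ne_top A1_one
    rw [lintegral_eq_zero_iff hG] at hG0
    have h2 : ∫⁻ x, G x ^ p * 1 = 0 := by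
      rw [lintegral_eq_zero_iff (by fun_prop)]
      filter_upwards [hG0] with x hx
      simp only [Pi.zero_apply] at hx ⊢
      rw [hx, ENNReal.zero_rpow_of_pos hp0, zero_mul]
    rw [h2, mul_zero, nonpos_iff_eq_zero, lintegral_eq_zero_iff (by fun_prop)] at h1
    have h3 : ∫⁻ x, F x ^ q * w x = 0 := by
      rw [lintegral_eq_zero_iff (by fun_prop)]
      filter_upwards [h1] with x hx
      simp only [Pi.zero_apply, mul_one] at hx ⊢
      rw [ENNReal.rpow_eq_zero_iff_of_pos hp0] at hx
      rw [hx, ENNReal.zero_rpow_of_pos hq0, zero_mul]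
    rw [h3]; exact zero_le
  set H := mx G with hH
  have hHm : Measurable H := measurable_mx G
  have hHpos : ∀ x, 0 < H x := mx_pos hG0
  have hst := strong_type hA hw hG hq
  have hHfin : ∀ᵐ x, H x < ∞ := by
    have h1 : ∫⁻ x, H x ^ q * w x ≠ ∞ :=
      ne_top_of_le_ne_top (ENNReal.mul_ne_top (SC_ne_top hq hK) hfin) hst
    filter_upwards [ae_lt_top (by fun_prop) h1, hwp] with x hx hwx
    by_contra hcon
    rw [not_lt, top_le_iff] at hcon
    rw [hcon, ENNReal.top_rpow_of_pos hq0, ENNReal.top_mul hwx.1.ne'] at hx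
    exact lt_irrefl _ hx
  have hvPF : PF (fun x => H x ^ d) := by
    filter_upwards [hHfin] with x hx
    exact ⟨ENNReal.rpow_pos (hHpos x) hx.ne, ENNReal.rpow_lt_top_of_nonneg hd0.le hx.ne⟩
  have hAp := Ap_of_A1 (p := p) (by linarith) hw (hHm.pow_const d) hwp hvPF hK (CR_ne_top hd0) hA
    (CR_A1 hd0 hd1 hG)
  have hWe : ∀ x, (H x ^ d) ^ (-(p - 1)) = H x ^ (-(p - q)) := by
    intro x
    rw [← ENNReal.rpow_mul]
    congr 1
    rw [hd]; field_simp
  simp only [hWe] at hAp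
  set W := fun x => w x * H x ^ (-(p - q)) with hW
  have hWm : Measurable W := by fun_prop
  have hWPF : PF W := by
    filter_upwards [hHfin, hwp] with x hx hwx
    have h1 : H x ^ (-(p - q)) ≠ ∞ := ENNReal.rpow_ne_top_of_ne_zero (hHpos x).ne' hx.ne
    have h2 : 0 < H x ^ (-(p - q)) := ENNReal.rpow_pos (hHpos x) hx.ne
    exact ⟨ENNReal.mul_pos hwx.1.ne' h2.ne', ENNReal.mul_lt_top hwx.2 h1.lt_top⟩
  have hKt : K * CR n d ^ (p - 1) ≠ ∞ :=
    ENNReal.mul_ne_top hK (ENNReal.rpow_ne_top_of_nonneg hp1.le (CR_ne_top hd0))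
  have hmain := hFG W hWm hWPF _ hKt hAp
  have hGle : ∫⁻ x, G x ^ p * W x ≤ ∫⁻ x, G x ^ q * w x := by
    apply lintegral_mono_ae
    filter_upwards [hHfin, le_mx hG] with x hx hGx
    have e : G x ^ p = G x ^ q * G x ^ (p - q) := by
      rw [← ENNReal.rpow_add_of_nonneg _ _ hq0.le hpq.le]; congr 1; ring
    calc G x ^ p * W x = G x ^ q * w x * (G x ^ (p - q) * (H x ^ (p - q))⁻¹) := by
          rw [e, hW]; simp only; rw [ENNReal.rpow_neg]; ring
      _ ≤ G x ^ q * w x * (H x ^ (p - q) * (H x ^ (p - q))⁻¹) := by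
          gcongr
      _ ≤ G x ^ q * w x * 1 := by gcongr; exact ENNReal.mul_inv_le_one _
      _ = _ := mul_one _
  set I := ∫⁻ x, G x ^ q * w x with hI
  have hconj : (p / q).HolderConjugate (p / (p - q)) := by
    rw [Real.holderConjugate_iff]
    refine ⟨by rw [one_lt_div hq0]; exact hqp, ?_⟩
    field_simp; ring
  have hhol := ENNReal.lintegral_mul_le_Lp_mul_Lq volume hconj
    (f := fun x => F x ^ q * W x ^ (q / p))
    (g := fun x => H x ^ ((p - q) * (q / p)) * w x ^ (1 - q / p))
    (by fun_prop) (by fun_prop)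
  have hL : ∫⁻ x, F x ^ q * w x = ∫⁻ x, ((fun x => F x ^ q * W x ^ (q / p)) *
      (fun x => H x ^ ((p - q) * (q / p)) * w x ^ (1 - q / p))) x := by
    apply lintegral_congr_ae
    filter_upwards [hHfin, hwp] with x hx hwx
    simp only [Pi.mul_apply, hW]
    rw [ENNReal.mul_rpow_of_nonneg _ _ (by positivity), ← ENNReal.rpow_mul]
    have e1 : w x ^ (q / p) * w x ^ (1 - q / p) = w x := by
      rw [← ENNReal.rpow_add _ _ hwx.1.ne' hwx.2.ne]
      simp
    have e2 : H x ^ (-(p - q) * (q / p)) * H x ^ ((p - q) * (q / p)) = 1 := by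
      rw [← ENNReal.rpow_add _ _ (hHpos x).ne' hx.ne]
      rw [show -(p - q) * (q / p) + (p - q) * (q / p) = 0 by ring, ENNReal.rpow_zero]
    calc F x ^ q * w x = F x ^ q * (w x ^ (q / p) * w x ^ (1 - q / p)) *
          (H x ^ (-(p - q) * (q / p)) * H x ^ ((p - q) * (q / p))) := by rw [e1, e2, mul_one]
      _ = _ := by ring
  have hA1' : ∀ x, (F x ^ q * W x ^ (q / p)) ^ (p / q) = F x ^ p * W x := by
    intro x
    rw [ENNReal.mul_rpow_of_nonneg _ _ (by positivity), ← ENNReal.rpow_mul, ← ENNReal.rpow_mul,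
      show q * (p / q) = p by field_simp, show q / p * (p / q) = 1 by field_simp, ENNReal.rpow_one]
  have hA2' : ∀ x, (H x ^ ((p - q) * (q / p)) * w x ^ (1 - q / p)) ^ (p / (p - q)) =
      H x ^ q * w x := by
    intro x
    rw [ENNReal.mul_rpow_of_nonneg _ _ (by positivity), ← ENNReal.rpow_mul, ← ENNReal.rpow_mul,
      show (p - q) * (q / p) * (p / (p - q)) = q by field_simp,
      show (1 - q / p) * (p / (p - q)) = 1 by field_simp, ENNReal.rpow_one]
  simp only [hA1', hA2'] at hhol
  have hexp : (0:ℝ) ≤ 1 - q / p := by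
    rw [sub_nonneg, div_le_one hp0]; exact hqp.le
  have h1e : 1 / (p / (p - q)) = 1 - q / p := by field_simp
  have h2e : 1 / (p / q) = q / p := by field_simp
  rw [h1e, h2e] at hhol
  rw [hL]
  refine hhol.trans ?_
  calc (∫⁻ x, F x ^ p * W x) ^ (q / p) * (∫⁻ x, H x ^ q * w x) ^ (1 - q / p)
      ≤ (Φ (K * CR n d ^ (p - 1)) * I) ^ (q / p) * (SC n q K * I) ^ (1 - q / p) := by
        gcongr
        exact hmain.trans (by gcongr)
    _ = (Φ (K * CR n d ^ (p - 1)) ^ (q / p) * SC n q K ^ (1 - q / p)) *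
          (I ^ (q / p) * I ^ (1 - q / p)) := by
        rw [ENNReal.mul_rpow_of_nonneg _ _ (by positivity), ENNReal.mul_rpow_of_nonneg _ _ hexp]
        ring
    _ = _ := by
        rw [← ENNReal.rpow_add_of_nonneg _ _ (by positivity) hexp]
        simp

end BBMAux

namespace BBMAux

lemma tsum_rpow_le {x : ℕ → ℝ≥0∞} {s : ℝ} (hs0 : 0 < s) (hs1 : s ≤ 1) :
    (∑' k, x k) ^ s ≤ ∑' k, x k ^ s := by
  have h1 : ∀ t : Finset ℕ, (∑ k ∈ t, x k) ^ s ≤ ∑ k ∈ t, x k ^ s := by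
    intro t
    induction t using Finset.cons_induction with
    | empty => simp [hs0]
    | cons a t ha ih =>
      rw [Finset.sum_cons, Finset.sum_cons]
      exact (ENNReal.rpow_add_le_add_rpow _ _ hs0.le hs1).trans (add_le_add le_rfl ih)
  have h2 : Tendsto (fun t : Finset ℕ => (∑ k ∈ t, x k) ^ s) atTop (𝓝 ((∑' k, x k) ^ s)) :=
    Tendsto.ennrpow_const s ENNReal.summable.hasSum
  exact le_of_tendsto' h2 fun t => (h1 t).trans (ENNReal.sum_le_tsum t)

/-- dyadic annuli -/
def ann {n : ℕ} (c : Fin n → ℝ) (r : ℝ) (k : ℕ) : Set (Fin n → ℝ) :=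
  {x | (k = 0 ∨ 2 ^ k * r ≤ dist x c) ∧ dist x c ≤ 2 ^ (k + 1) * r}

lemma ann_sub {n : ℕ} (c : Fin n → ℝ) (r : ℝ) (k : ℕ) :
    ann c r k ⊆ Metric.closedBall c (2 ^ (k + 1) * r) := fun _ hx => hx.2

lemma ann_meas {n : ℕ} (c : Fin n → ℝ) (r : ℝ) (k : ℕ) : MeasurableSet (ann c r k) := by
  have h1 : Measurable (fun x : Fin n → ℝ => dist x c) := by fun_prop
  have h2 : ann c r k = ({x | k = 0} ∪ {x | 2 ^ k * r ≤ dist x c}) ∩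
      {x | dist x c ≤ 2 ^ (k + 1) * r} := rfl
  rw [h2]
  exact ((MeasurableSet.const _).union (measurableSet_le measurable_const h1)).inter
    (measurableSet_le h1 measurable_const)

lemma ann_cover {n : ℕ} (c : Fin n → ℝ) {r : ℝ} (hr : 0 < r) : (⋃ k, ann c r k) = Set.univ := by
  rw [Set.eq_univ_iff_forall]
  intro x
  rw [Set.mem_iUnion]
  by_cases h : dist x c ≤ 2 * r
  · exact ⟨0, Or.inl rfl, by simpa using h⟩
  · push Not at h
    obtain ⟨k, hk1, hk2⟩ := exists_nat_pow_near (x := dist x c / r) (y := 2)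
      (by rw [one_le_div hr]; linarith) (by norm_num)
    rw [le_div_iff₀ hr] at hk1
    rw [div_lt_iff₀ hr] at hk2
    exact ⟨k, Or.inr hk1, hk2.le⟩

lemma lint_ann {n : ℕ} (c : Fin n → ℝ) {r : ℝ} (hr : 0 < r) (f : (Fin n → ℝ) → ℝ≥0∞) :
    ∫⁻ x, f x ≤ ∑' k, ∫⁻ x in ann c r k, f x := by
  have := lintegral_iUnion_le (μ := volume) (ann c r) f
  rwa [ann_cover c hr, Measure.restrict_univ] at this

lemma two_pow_neg (n k : ℕ) : ENNReal.ofReal (2 ^ (k * n)) = (2:ℝ≥0∞) ^ ((k:ℝ) * n) := by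
  rw [ENNReal.ofReal_pow (by norm_num), ENNReal.ofReal_ofNat, ← ENNReal.rpow_natCast]
  congr 1; push_cast; ring

lemma mx_ann {n : ℕ} {f : (Fin n → ℝ) → ℝ≥0∞} {c x : Fin n → ℝ} {r : ℝ} (hr : 0 < r)
    (hsupp : ∀ y, y ∉ Metric.closedBall c r → f y = 0) {k : ℕ} (hk : k ≠ 0) (hx : x ∈ ann c r k) :
    mx f x ≤ (4:ℝ≥0∞) ^ n * (2:ℝ≥0∞) ^ (-((k:ℝ) * n)) * av f c r := by
  have h2k : (2:ℝ) ≤ 2 ^ k := by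
    calc (2:ℝ) = 2 ^ 1 := by norm_num
      _ ≤ 2 ^ k := pow_le_pow_right₀ (by norm_num) (Nat.one_le_iff_ne_zero.mpr hk)
  have h1 := mx_decay hr hsupp (s := 2 ^ k * r) (by gcongr) (hx.1.resolve_left hk)
  refine h1.trans (le_of_eq ?_)
  have hIntEq : ∫⁻ y, f y = ∫⁻ y in Metric.closedBall c r, f y := by
    rw [← lintegral_indicator Metric.isClosed_closedBall.measurableSet]
    congr 1; ext y
    by_cases hy : y ∈ Metric.closedBall c r
    · rw [Set.indicator_of_mem hy]
    · rw [Set.indicator_of_notMem hy, hsupp y hy]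
  have h4 : ENNReal.ofReal ((2 ^ k / 4) ^ n) = (2:ℝ≥0∞) ^ ((k:ℝ) * n) / 4 ^ n := by
    rw [div_pow, ENNReal.ofReal_div_of_pos (by positivity), ← pow_mul, two_pow_neg,
      ENNReal.ofReal_pow (by norm_num), ENNReal.ofReal_ofNat]
  unfold av
  rw [hIntEq, show 2 ^ k * r / 4 = (2 ^ k / 4) * r by ring, cv_mul (by positivity), h4,
    ENNReal.mul_inv (Or.inr cv_ne_top) (Or.inr (cv_ne_zero hr)),
    ENNReal.inv_div (Or.inl (by finiteness)) (Or.inl (by positivity)), div_eq_mul_inv,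
    ← ENNReal.rpow_neg]
  ring

lemma local_down {n : ℕ} {p q θ : ℝ} (hq : 1 < q) (hqp : q ≤ p) (hθ0 : 0 < θ) (hθ1 : θ < 1)
    {Φ : ℝ≥0∞ → ℝ≥0∞} (hΦ : ∀ K, Φ K ≠ ∞) :
    ∃ C : ℝ≥0∞, C ≠ ∞ ∧ ∀ F G : (Fin n → ℝ) → ℝ≥0∞, Measurable F → Measurable G → Fam p Φ F G →
      ∀ c r, 0 < r → ∫⁻ x in Metric.closedBall c r, F x ^ q ≤
        C * ∑' k : ℕ, (2:ℝ≥0∞) ^ (-((k:ℝ) * n) * θ) *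
          ∫⁻ x in Metric.closedBall c (2 ^ (k + 1) * r), G x ^ q := by
  have hp1 : 1 < p := by linarith
  have hK : CR n θ ≠ ∞ := CR_ne_top hθ0
  obtain ⟨C0, hC0, hmain⟩ : ∃ C0 : ℝ≥0∞, C0 ≠ ∞ ∧ ∀ F G : (Fin n → ℝ) → ℝ≥0∞,
      Measurable F → Measurable G → Fam p Φ F G → ∀ w : (Fin n → ℝ) → ℝ≥0∞, Measurable w →
      PF w → A1 (CR n θ) w → ∫⁻ x, G x ^ q * w x ≠ ∞ →
      ∫⁻ x, F x ^ q * w x ≤ C0 * ∫⁻ x, G x ^ q * w x := by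
    rcases hqp.eq_or_lt with rfl | hlt
    · exact ⟨Φ (CR n θ), hΦ _, fun F G _ _ hFG w hw hwp hA _ => Fam_A1 hq hFG hw hwp hK hA⟩
    · refine ⟨_, ?_, fun F G hF hG hFG w hw hwp hA hfin =>
        extrap_down hq hlt hF hG hFG hw hwp hK hA hfin⟩
      apply ENNReal.mul_ne_top
      · exact ENNReal.rpow_ne_top_of_nonneg (by positivity) (hΦ _)
      · refine ENNReal.rpow_ne_top_of_nonneg ?_ (SC_ne_top hq hK)
        rw [sub_nonneg, div_le_one (by linarith)]; exact hqp
  have h4t : ((4:ℝ≥0∞) ^ n) ^ θ ≠ ∞ := ENNReal.rpow_ne_top_of_nonneg hθ0.le (by finiteness)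
  refine ⟨(C0 + 1) * ((4:ℝ≥0∞) ^ n) ^ θ, by finiteness, ?_⟩
  intro F G hF hG hFG c r hr
  have hBm : MeasurableSet (Metric.closedBall c r) := Metric.isClosed_closedBall.measurableSet
  set f : (Fin n → ℝ) → ℝ≥0∞ := (Metric.closedBall c r).indicator 1 with hf
  have hfm : Measurable f := measurable_one.indicator hBm
  have hf1 : ∀ x, f x ≤ 1 := fun x => Set.indicator_le_self' (fun _ _ => zero_le) x
  have hfi : ∫⁻ x, f x ≠ 0 := by
    rw [hf, lintegral_indicator_one hBm, vol_cb c hr.le]; exact cv_ne_zero hr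
  set w := fun x => mx f x ^ θ with hwdef
  have hwm : Measurable w := (measurable_mx f).pow_const θ
  have hmx1 : ∀ x, mx f x ≤ 1 := mx_le_of_le hf1
  have hw1 : ∀ x, w x ≤ 1 := fun x => ENNReal.rpow_le_one (hmx1 x) hθ0.le
  have hwp : PF w := Eventually.of_forall fun x =>
    ⟨ENNReal.rpow_pos (mx_pos hfi x) (ne_top_of_le_ne_top ENNReal.one_ne_top (hmx1 x)),
      (hw1 x).trans_lt ENNReal.one_lt_top⟩
  have hA : A1 (CR n θ) w := CR_A1 hθ0 hθ1 hfm
  have h4 : 1 ≤ ((4:ℝ≥0∞) ^ n) ^ θ :=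
    ENNReal.one_le_rpow (one_le_pow_of_one_le' (by norm_num) n) hθ0
  have hann : ∀ k, ∀ x ∈ ann c r k, w x ≤ ((4:ℝ≥0∞) ^ n) ^ θ * (2:ℝ≥0∞) ^ (-((k:ℝ) * n) * θ) := by
    intro k x hx
    by_cases hk : k = 0
    · subst hk
      simpa using (hw1 x).trans h4
    · have h1 := mx_ann hr (f := f) (fun y hy => Set.indicator_of_notMem hy _) hk hx
      have h2 : mx f x ≤ (4:ℝ≥0∞) ^ n * (2:ℝ≥0∞) ^ (-((k:ℝ) * n)) :=
        h1.trans (mul_le_of_le_one_right' (av_le_of_le hr fun y _ => hf1 y))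
      rw [ENNReal.rpow_mul, ← ENNReal.mul_rpow_of_nonneg _ _ hθ0.le]
      exact ENNReal.rpow_le_rpow h2 hθ0.le
  have hR : ∫⁻ x, G x ^ q * w x ≤ ((4:ℝ≥0∞) ^ n) ^ θ * ∑' k : ℕ, (2:ℝ≥0∞) ^ (-((k:ℝ) * n) * θ) *
          ∫⁻ x in Metric.closedBall c (2 ^ (k + 1) * r), G x ^ q := by
    refine (lint_ann c hr _).trans ?_
    rw [← ENNReal.tsum_mul_left]
    refine ENNReal.tsum_le_tsum fun k => ?_
    calc ∫⁻ x in ann c r k, G x ^ q * w x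
        ≤ ∫⁻ x in ann c r k, (((4:ℝ≥0∞) ^ n) ^ θ * (2:ℝ≥0∞) ^ (-((k:ℝ) * n) * θ)) * G x ^ q := by
          apply setLIntegral_mono' (ann_meas c r k)
          intro x hx
          rw [mul_comm]
          gcongr
          exact hann k x hx
      _ = (((4:ℝ≥0∞) ^ n) ^ θ * (2:ℝ≥0∞) ^ (-((k:ℝ) * n) * θ)) * ∫⁻ x in ann c r k, G x ^ q := by
          rw [lintegral_const_mul _ (by fun_prop)]
      _ ≤ (((4:ℝ≥0∞) ^ n) ^ θ * (2:ℝ≥0∞) ^ (-((k:ℝ) * n) * θ)) *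
          ∫⁻ x in Metric.closedBall c (2 ^ (k + 1) * r), G x ^ q := by
          gcongr
          exact ann_sub c r k
      _ = _ := by ring
  have hL : ∫⁻ x in Metric.closedBall c r, F x ^ q ≤ ∫⁻ x, F x ^ q * w x := by
    rw [← lintegral_indicator hBm]
    apply lintegral_mono_ae
    filter_upwards [le_mx hfm] with x hx
    by_cases hxB : x ∈ Metric.closedBall c r
    · rw [Set.indicator_of_mem hxB]
      have h1 : 1 ≤ mx f x := by simpa [hf, Set.indicator_of_mem hxB] using hx
      exact le_mul_of_one_le_right' (ENNReal.one_le_rpow h1 hθ0)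
    · rw [Set.indicator_of_notMem hxB]; exact zero_le
  by_cases hfin : ∫⁻ x, G x ^ q * w x = ∞
  · rw [hfin, top_le_iff] at hR
    rw [mul_assoc, hR, ENNReal.mul_top (by positivity)]
    exact le_top
  · refine hL.trans ((hmain F G hF hG hFG w hwm hwp hA hfin).trans ?_)
    rw [mul_assoc]
    gcongr
    exact le_self_add

/-- Jensen -/
lemma av_jensen {n : ℕ} {f : (Fin n → ℝ) → ℝ≥0∞} (hf : Measurable f) {t : ℝ} (ht : 1 < t)
    (c : Fin n → ℝ) {r : ℝ} (hr : 0 < r) : av f c r ≤ (av (fun x => f x ^ t) c r) ^ (1 / t) := by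
  have hconj := Real.HolderConjugate.conjExponent ht
  have h := ENNReal.lintegral_mul_le_Lp_mul_Lq (volume.restrict (Metric.closedBall c r)) hconj
    (f := f) (g := fun _ => 1) hf.aemeasurable measurable_const.aemeasurable
  simp only [Pi.mul_apply, mul_one, ENNReal.one_rpow, lintegral_const,
    Measure.restrict_apply_univ, vol_cb c hr.le, one_mul] at h
  have e : 1 / t.conjExponent = 1 - 1 / t := by
    have := hconj.inv_add_inv_eq_one
    simp only [one_div]; linarith
  rw [e] at h
  unfold av
  rw [ENNReal.mul_rpow_of_nonneg _ _ (by positivity)]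
  refine (mul_le_mul_right h _).trans (le_of_eq ?_)
  rw [ENNReal.rpow_sub _ _ (cv_ne_zero hr) cv_ne_top, ENNReal.rpow_one, ENNReal.inv_rpow,
    div_eq_mul_inv (cv n r)]
  set S := (∫⁻ x in Metric.closedBall c r, f x ^ t) ^ (1 / t)
  calc (cv n r)⁻¹ * (S * (cv n r * (cv n r ^ (1 / t))⁻¹))
      = ((cv n r)⁻¹ * cv n r) * ((cv n r ^ (1 / t))⁻¹ * S) := by ring
    _ = _ := by rw [ENNReal.inv_mul_cancel (cv_ne_zero hr) cv_ne_top, one_mul]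

end BBMAux

namespace BBMAux

lemma mx_ann_int {n : ℕ} {t : ℝ} (ht : 1 < t) {f : (Fin n → ℝ) → ℝ≥0∞} (hf : Measurable f)
    {c : Fin n → ℝ} {r : ℝ} (hr : 0 < r)
    (hsupp : ∀ y, y ∉ Metric.closedBall c r → f y = 0) (k : ℕ) :
    ∫⁻ x in ann c r k, mx f x ^ t ≤ (SC n t 1 + 2 ^ n * ((4:ℝ≥0∞) ^ n) ^ t) *
      ((2:ℝ≥0∞) ^ (-((k:ℝ) * n) * (t - 1)) * ∫⁻ x, f x ^ t) := by
  have ht0 : 0 < t := by linarith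
  by_cases hk : k = 0
  · subst hk
    have h1 := strong_type (n := n) A1_one measurable_const hf ht
    simp only [mul_one] at h1
    calc ∫⁻ x in ann c r 0, mx f x ^ t ≤ ∫⁻ x, mx f x ^ t := setLIntegral_le_lintegral _ _
      _ ≤ _ := h1
      _ ≤ _ := by
        simp only [Nat.cast_zero, zero_mul, neg_zero, ENNReal.rpow_zero, one_mul]
        gcongr
        exact le_self_add
  · have hIntEq : ∫⁻ x in Metric.closedBall c r, f x ^ t ≤ ∫⁻ x, f x ^ t :=
      setLIntegral_le_lintegral _ _
    have hpt : ∀ x ∈ ann c r k, mx f x ^ t ≤ ((4:ℝ≥0∞) ^ n) ^ t * (2:ℝ≥0∞) ^ (-((k:ℝ) * n) * t) *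
        av (fun x => f x ^ t) c r := by
      intro x hx
      have h1 := mx_ann hr hsupp hk hx
      have h2 := h1.trans (mul_le_mul_right (av_jensen hf ht c hr) _)
      have h3 := ENNReal.rpow_le_rpow h2 ht0.le
      rwa [ENNReal.mul_rpow_of_nonneg _ _ ht0.le, ENNReal.mul_rpow_of_nonneg _ _ ht0.le,
        ← ENNReal.rpow_mul, ← ENNReal.rpow_mul _ (1 / t), one_div_mul_cancel ht0.ne',
        ENNReal.rpow_one] at h3
    calc ∫⁻ x in ann c r k, mx f x ^ t
        ≤ ∫⁻ x in ann c r k, ((4:ℝ≥0∞) ^ n) ^ t * (2:ℝ≥0∞) ^ (-((k:ℝ) * n) * t) *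
            av (fun x => f x ^ t) c r := setLIntegral_mono' (ann_meas c r k) hpt
      _ = ((4:ℝ≥0∞) ^ n) ^ t * (2:ℝ≥0∞) ^ (-((k:ℝ) * n) * t) *
            av (fun x => f x ^ t) c r * volume (ann c r k) := by
          rw [lintegral_const, Measure.restrict_apply_univ]
      _ ≤ ((4:ℝ≥0∞) ^ n) ^ t * (2:ℝ≥0∞) ^ (-((k:ℝ) * n) * t) *
            ((cv n r)⁻¹ * ∫⁻ x, f x ^ t) * (2 ^ n * (2:ℝ≥0∞) ^ ((k:ℝ) * n) * cv n r) := by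
          have hv : volume (ann c r k) ≤ 2 ^ n * (2:ℝ≥0∞) ^ ((k:ℝ) * n) * cv n r := by
            refine (measure_mono (ann_sub c r k)).trans (le_of_eq ?_)
            rw [vol_cb c (by positivity), cv_mul (by positivity), ← pow_mul, add_mul, pow_add,
              ENNReal.ofReal_mul (by positivity), two_pow_neg, one_mul,
              ENNReal.ofReal_pow (by norm_num), ENNReal.ofReal_ofNat]
            ring
          unfold av
          gcongr
      _ = ((cv n r)⁻¹ * cv n r) * (2 ^ n * ((4:ℝ≥0∞) ^ n) ^ t * (((2:ℝ≥0∞) ^ (-((k:ℝ) * n) * t) *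
            (2:ℝ≥0∞) ^ ((k:ℝ) * n)) * ∫⁻ x, f x ^ t)) := by ring
      _ = 2 ^ n * ((4:ℝ≥0∞) ^ n) ^ t * ((2:ℝ≥0∞) ^ (-((k:ℝ) * n) * (t - 1)) * ∫⁻ x, f x ^ t) := by
          rw [ENNReal.inv_mul_cancel (cv_ne_zero hr) cv_ne_top, one_mul,
            ← ENNReal.rpow_add _ _ (by norm_num) (by norm_num)]
          congr 4; ring
      _ ≤ _ := by
          gcongr
          exact le_add_self

lemma local_up_trunc {n : ℕ} {p q θ : ℝ} (hp : 1 < p) (hpq : p < q) (hθ0 : 0 < θ) (hθ1 : θ < 1)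
    {Φ : ℝ≥0∞ → ℝ≥0∞} {δ : ℝ} (hδ : δ = 1 - (1 - θ) * (p / q)) {t : ℝ} (ht : t = δ * (q / (q - p)))
    {F G u : (Fin n → ℝ) → ℝ≥0∞} (hG : Measurable G) (hu : Measurable u) (hFG : Fam p Φ F G)
    (huF : ∀ x, u x ≤ F x) {j : ℝ≥0∞} (hj : j ≠ ∞) (huj : ∀ x, u x ≤ j)
    (c : Fin n → ℝ) {r : ℝ} (hr : 0 < r) :
    (∫⁻ x in Metric.closedBall c r, u x ^ q) ^ (p / q) ≤
        (Φ (CR n δ) * (SC n t 1 + 2 ^ n * ((4:ℝ≥0∞) ^ n) ^ t) ^ (1 - p / q)) *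
        ∑' k : ℕ, (2:ℝ≥0∞) ^ (-((k:ℝ) * n) * (θ * (p / q))) *
          (∫⁻ x in Metric.closedBall c (2 ^ (k + 1) * r), G x ^ q) ^ (p / q) := by
  have hq0 : 0 < q := by linarith
  have hp0 : 0 < p := by linarith
  have hpq0 : 0 < p / q := by positivity
  have hpq1 : p / q < 1 := by rw [div_lt_one hq0]; exact hpq
  have hqp0 : 0 < q - p := by linarith
  have hδ1 : δ < 1 := by nlinarith
  have hδ2 : 1 - p / q < δ := by nlinarith
  have hδ0 : 0 < δ := by linarith
  have es : q / (q - p) = 1 / (1 - p / q) := by field_simp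
  have ht1 : 1 < t := by
    rw [ht, es, mul_one_div, one_lt_div (by linarith)]; exact hδ2
  set C1 := SC n t 1 + 2 ^ n * ((4:ℝ≥0∞) ^ n) ^ t
  have hBm : MeasurableSet (Metric.closedBall c r) := Metric.isClosed_closedBall.measurableSet
  set I := ∫⁻ x in Metric.closedBall c r, u x ^ q with hI
  by_cases hI0 : I = 0
  · rw [hI0, ENNReal.zero_rpow_of_pos hpq0]; exact zero_le
  have hIt : I ≠ ∞ := by
    have : I ≤ j ^ q * cv n r := by
      calc I ≤ ∫⁻ x in Metric.closedBall c r, j ^ q :=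
            lintegral_mono fun x => ENNReal.rpow_le_rpow (huj x) hq0.le
        _ = _ := by rw [lintegral_const, Measure.restrict_apply_univ, vol_cb c hr.le]
    refine ne_top_of_le_ne_top (ENNReal.mul_ne_top ?_ cv_ne_top) this
    exact ENNReal.rpow_ne_top_of_nonneg hq0.le hj
  set φ : (Fin n → ℝ) → ℝ≥0∞ := (Metric.closedBall c r).indicator fun x => u x ^ ((q - p) / δ)
    with hφ
  have hφm : Measurable φ := (hu.pow_const _).indicator hBm
  have hφt : ∫⁻ x, φ x ^ t = I := by
    rw [hI, ← lintegral_indicator hBm]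
    congr 1; ext x
    by_cases hx : x ∈ Metric.closedBall c r
    · rw [hφ, Set.indicator_of_mem hx, Set.indicator_of_mem hx, ← ENNReal.rpow_mul]
      congr 1; rw [ht]; field_simp
    · rw [hφ, Set.indicator_of_notMem hx, Set.indicator_of_notMem hx,
        ENNReal.zero_rpow_of_pos (by linarith)]
  have hφ0 : ∫⁻ x, φ x ≠ 0 := by
    intro h0
    apply hI0
    rw [lintegral_eq_zero_iff hφm] at h0
    rw [← hφt, lintegral_eq_zero_iff (by fun_prop)]
    filter_upwards [h0] with x hx
    simp only [Pi.zero_apply] at hx ⊢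
    rw [hx, ENNReal.zero_rpow_of_pos (by linarith)]
  have hφj : ∀ x, φ x ≤ j ^ ((q - p) / δ) := by
    intro x
    by_cases hx : x ∈ Metric.closedBall c r
    · rw [hφ, Set.indicator_of_mem hx]
      exact ENNReal.rpow_le_rpow (huj x) (by positivity)
    · rw [hφ, Set.indicator_of_notMem hx]; exact zero_le
  have hjt : j ^ ((q - p) / δ) ≠ ∞ := ENNReal.rpow_ne_top_of_nonneg (by positivity) hj
  have hmt : ∀ x, mx φ x ≠ ∞ := fun x => ne_top_of_le_ne_top hjt (mx_le_of_le hφj x)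
  set H := fun x => mx φ x ^ δ with hH
  have hHm : Measurable H := (measurable_mx φ).pow_const δ
  have hHp : PF H := Eventually.of_forall fun x =>
    ⟨ENNReal.rpow_pos (mx_pos hφ0 x) (hmt x),
      lt_top_iff_ne_top.mpr (ENNReal.rpow_ne_top_of_nonneg hδ0.le (hmt x))⟩
  have hA : A1 (CR n δ) H := CR_A1 hδ0 hδ1 hφm
  have h1 : I ≤ ∫⁻ x, F x ^ p * H x := by
    rw [hI, ← lintegral_indicator hBm]
    apply lintegral_mono_ae
    filter_upwards [le_mx hφm] with x hx
    by_cases hxB : x ∈ Metric.closedBall c r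
    · rw [Set.indicator_of_mem hxB]
      rw [hφ, Set.indicator_of_mem hxB] at hx
      have h2 := ENNReal.rpow_le_rpow hx hδ0.le
      rw [← ENNReal.rpow_mul, div_mul_cancel₀ _ hδ0.ne'] at h2
      calc u x ^ q = u x ^ p * u x ^ (q - p) := by
            rw [← ENNReal.rpow_add_of_nonneg _ _ hp0.le hqp0.le]; congr 1; ring
        _ ≤ F x ^ p * H x := by
            gcongr
            exact huF x
    · rw [Set.indicator_of_notMem hxB]; exact zero_le
  have h2 : I ≤ Φ (CR n δ) * ∫⁻ x, G x ^ p * H x :=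
    h1.trans (Fam_A1 hp hFG hHm hHp (CR_ne_top hδ0) hA)
  have hconj : (q / p).HolderConjugate (q / (q - p)) := by
    rw [Real.holderConjugate_iff]
    refine ⟨by rwa [one_lt_div hp0], ?_⟩
    field_simp; ring
  have hk : ∀ k, ∫⁻ x in ann c r k, G x ^ p * H x ≤
      (C1 * I) ^ (1 - p / q) * ((2:ℝ≥0∞) ^ (-((k:ℝ) * n) * (θ * (p / q))) *
          (∫⁻ x in Metric.closedBall c (2 ^ (k + 1) * r), G x ^ q) ^ (p / q)) := by
    intro k
    have h3 := ENNReal.lintegral_mul_le_Lp_mul_Lq (volume.restrict (ann c r k)) hconj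
      (f := fun x => G x ^ p) (g := H) (hG.pow_const p).aemeasurable hHm.aemeasurable
    simp only [Pi.mul_apply, ← ENNReal.rpow_mul, hH] at h3
    rw [show p * (q / p) = q by field_simp, ← ht, es, one_div_one_div,
      show 1 / (q / p) = p / q by field_simp] at h3
    have h4 := mx_ann_int ht1 hφm hr (fun y hy => Set.indicator_of_notMem hy _) k
    rw [hφt] at h4
    have h5 : (∫⁻ x in ann c r k, mx φ x ^ t) ^ (1 - p / q) ≤
        (C1 * I) ^ (1 - p / q) * (2:ℝ≥0∞) ^ (-((k:ℝ) * n) * (θ * (p / q))) := by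
      refine (ENNReal.rpow_le_rpow h4 (by linarith)).trans (le_of_eq ?_)
      rw [mul_left_comm, mul_comm, ENNReal.mul_rpow_of_nonneg _ _ (by linarith),
        ← ENNReal.rpow_mul]
      congr 2
      rw [mul_assoc]
      congr 1
      rw [ht, es, hδ]
      have : 1 - p / q ≠ 0 := by linarith
      field_simp
      ring
    refine h3.trans ?_
    rw [mul_comm, ← mul_assoc]
    have h6 : ∫⁻ x in ann c r k, G x ^ q ≤
      ∫⁻ x in Metric.closedBall c (2 ^ (k + 1) * r), G x ^ q := by
        gcongr
        exact ann_sub c r k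
    gcongr
  have h7 : I ≤ Φ (CR n δ) * ((C1 * I) ^ (1 - p / q) *
      ∑' k : ℕ, (2:ℝ≥0∞) ^ (-((k:ℝ) * n) * (θ * (p / q))) *
          (∫⁻ x in Metric.closedBall c (2 ^ (k + 1) * r), G x ^ q) ^ (p / q)) := by
    refine h2.trans ?_
    gcongr
    refine (lint_ann c hr _).trans ?_
    rw [← ENNReal.tsum_mul_left]
    exact ENNReal.tsum_le_tsum hk
  have hIs0 : I ^ (1 - p / q) ≠ 0 := by
    rw [← pos_iff_ne_zero]
    exact ENNReal.rpow_pos (pos_iff_ne_zero.mpr hI0) hIt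
  have hIst : I ^ (1 - p / q) ≠ ∞ := ENNReal.rpow_ne_top_of_nonneg (by linarith) hIt
  rw [← ENNReal.mul_le_mul_iff_right hIs0 hIst,
    ← ENNReal.rpow_add_of_nonneg _ _ (by linarith) hpq0.le, sub_add_cancel, ENNReal.rpow_one]
  refine h7.trans (le_of_eq ?_)
  rw [ENNReal.mul_rpow_of_nonneg _ _ (by linarith)]
  ring

lemma local_up {n : ℕ} {p q θ : ℝ} (hp : 1 < p) (hpq : p < q) (hθ0 : 0 < θ) (hθ1 : θ < 1)
    {Φ : ℝ≥0∞ → ℝ≥0∞} (hΦ : ∀ K, Φ K ≠ ∞) :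
    ∃ C : ℝ≥0∞, C ≠ ∞ ∧ ∀ F G : (Fin n → ℝ) → ℝ≥0∞, Measurable F → Measurable G → Fam p Φ F G →
      ∀ c r, 0 < r → (∫⁻ x in Metric.closedBall c r, F x ^ q) ^ (p / q) ≤
        C * ∑' k : ℕ, (2:ℝ≥0∞) ^ (-((k:ℝ) * n) * (θ * (p / q))) *
          (∫⁻ x in Metric.closedBall c (2 ^ (k + 1) * r), G x ^ q) ^ (p / q) := by
  have hq0 : 0 < q := by linarith
  have hpq0 : 0 < p / q := by positivity
  have hpq1 : p / q < 1 := by rw [div_lt_one hq0]; exact hpq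
  have hδ2 : 1 - p / q < 1 - (1 - θ) * (p / q) := by nlinarith
  have es : q / (q - p) = 1 / (1 - p / q) := by
    have : q - p ≠ 0 := by linarith
    field_simp
  have ht1 : 1 < (1 - (1 - θ) * (p / q)) * (q / (q - p)) := by
    rw [es, mul_one_div, one_lt_div (by linarith)]; exact hδ2
  refine ⟨Φ (CR n (1 - (1 - θ) * (p / q))) *
    (SC n ((1 - (1 - θ) * (p / q)) * (q / (q - p))) 1 + 2 ^ n *
      ((4:ℝ≥0∞) ^ n) ^ ((1 - (1 - θ) * (p / q)) * (q / (q - p)))) ^ (1 - p / q), ?_,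
    fun F G hF hG hFG c r hr => ?_⟩
  rotate_left
  · have hlim : Tendsto (fun j : ℕ => (∫⁻ x in Metric.closedBall c r, (min (F x) (j:ℝ≥0∞)) ^ q)
        ^ (p / q)) atTop (𝓝 ((∫⁻ x in Metric.closedBall c r, F x ^ q) ^ (p / q))) := by
      refine Tendsto.ennrpow_const _ ?_
      refine lintegral_tendsto_of_tendsto_of_monotone ?_ ?_ ?_
      · intro j
        exact ((hF.min measurable_const).pow_const q).aemeasurable
      · refine Eventually.of_forall fun x => ?_
        intro i j hij
        refine ENNReal.rpow_le_rpow (min_le_min le_rfl ?_) hq0.le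
        exact_mod_cast hij
      · refine Eventually.of_forall fun x => ?_
        refine Tendsto.ennrpow_const _ ?_
        have := (tendsto_const_nhds (x := F x)).min ENNReal.tendsto_nat_nhds_top
        simpa using this
    refine le_of_tendsto' hlim fun j => ?_
    exact local_up_trunc hp hpq hθ0 hθ1 rfl rfl hG (hF.min measurable_const) hFG
      (fun x => min_le_left _ _) (ENNReal.natCast_ne_top j) (fun x => min_le_right _ _) c hr
  · have h4 : ((4:ℝ≥0∞) ^ n) ^ ((1 - (1 - θ) * (p / q)) * (q / (q - p))) ≠ ∞ :=
      ENNReal.rpow_ne_top_of_nonneg (by linarith) (by finiteness)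
    have h5 := SC_ne_top (n := n) ht1 ENNReal.one_ne_top
    refine ENNReal.mul_ne_top (hΦ _) (ENNReal.rpow_ne_top_of_nonneg (by linarith) ?_)
    finiteness

/-- The unified local estimate. -/
lemma local_all {n : ℕ} {p q θ : ℝ} (hp : 1 < p) (hq : 1 < q) (hθ0 : 0 < θ) (hθ1 : θ < 1)
    {Φ : ℝ≥0∞ → ℝ≥0∞} (hΦ : ∀ K, Φ K ≠ ∞) :
    ∃ C : ℝ≥0∞, C ≠ ∞ ∧ ∀ F G : (Fin n → ℝ) → ℝ≥0∞, Measurable F → Measurable G → Fam p Φ F G →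
      ∀ c r, 0 < r → (∫⁻ x in Metric.closedBall c r, F x ^ q) ^ (1 / q) ≤
        C * ∑' k : ℕ, (2:ℝ≥0∞) ^ (-((k:ℝ) * n) * (θ / q)) *
          (∫⁻ x in Metric.closedBall c (2 ^ (k + 1) * r), G x ^ q) ^ (1 / q) := by
  have hq0 : 0 < q := by linarith
  have hp0 : 0 < p := by linarith
  rcases le_or_gt q p with h | h
  · obtain ⟨C, hC, hmain⟩ := local_down (n := n) hq h hθ0 hθ1 hΦ
    refine ⟨C ^ (1 / q), ENNReal.rpow_ne_top_of_nonneg (by positivity) hC, ?_⟩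
    intro F G hF hG hFG c r hr
    refine (ENNReal.rpow_le_rpow (hmain F G hF hG hFG c r hr) (by positivity)).trans ?_
    rw [ENNReal.mul_rpow_of_nonneg _ _ (by positivity)]
    gcongr
    refine (tsum_rpow_le (by positivity) (by rw [div_le_one hq0]; exact hq.le)).trans (le_of_eq ?_)
    congr 1; ext k
    rw [ENNReal.mul_rpow_of_nonneg _ _ (by positivity), ← ENNReal.rpow_mul]
    congr 2; ring
  · obtain ⟨C, hC, hmain⟩ := local_up (n := n) hp h hθ0 hθ1 hΦ
    refine ⟨C ^ (1 / p), ENNReal.rpow_ne_top_of_nonneg (by positivity) hC, ?_⟩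
    intro F G hF hG hFG c r hr
    have h1 := ENNReal.rpow_le_rpow (hmain F G hF hG hFG c r hr) (z := 1 / p) (by positivity)
    have e : p / q * (1 / p) = 1 / q := by field_simp
    rw [← ENNReal.rpow_mul, e] at h1
    refine h1.trans ?_
    rw [ENNReal.mul_rpow_of_nonneg _ _ (by positivity)]
    gcongr
    refine (tsum_rpow_le (by positivity) (by rw [div_le_one hp0]; exact hp.le)).trans (le_of_eq ?_)
    congr 1; ext k
    rw [ENNReal.mul_rpow_of_nonneg _ _ (by positivity), ← ENNReal.rpow_mul, ← ENNReal.rpow_mul, e]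
    congr 2
    field_simp

end BBMAux

namespace BBMAux

/-- geometric constant -/
def GC (b : ℝ) : ℝ≥0∞ := ∑' k : ℕ, (2:ℝ≥0∞) ^ (-(k:ℝ) * b)

lemma GC_ne_top {b : ℝ} (hb : 0 < b) : GC b ≠ ∞ := by
  have h1 : ∀ k : ℕ, (2:ℝ≥0∞) ^ (-(k:ℝ) * b) = ((2:ℝ≥0∞) ^ (-b)) ^ k := by
    intro k
    rw [← ENNReal.rpow_natCast, ← ENNReal.rpow_mul]; congr 1; ring
  unfold GC
  simp_rw [h1]
  rw [ENNReal.tsum_geometric]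
  have h2 : (2:ℝ≥0∞) ^ (-b) < 1 := ENNReal.rpow_lt_one_of_one_lt_of_neg (by norm_num) (by linarith)
  rw [ENNReal.inv_ne_top]
  exact (tsub_pos_of_lt h2).ne'

lemma tsum_geo {x : ℕ → ℝ≥0∞} {s a b : ℝ} (hs : 0 < s) :
    (∑' k : ℕ, (2:ℝ≥0∞) ^ (-(k:ℝ) * b) * x k) ^ s ≤
      GC (b - a) ^ s * ∑' k : ℕ, (2:ℝ≥0∞) ^ (-(k:ℝ) * (a * s)) * x k ^ s := by
  set S := ∑' k : ℕ, (2:ℝ≥0∞) ^ (-(k:ℝ) * (a * s)) * x k ^ s with hS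
  have h1 : ∀ k : ℕ, (2:ℝ≥0∞) ^ (-(k:ℝ) * a) * x k ≤ S ^ (1 / s) := by
    intro k
    rw [one_div, ENNReal.le_rpow_inv_iff hs, ENNReal.mul_rpow_of_nonneg _ _ hs.le,
      ← ENNReal.rpow_mul, mul_assoc]
    exact ENNReal.le_tsum (f := fun k : ℕ => (2:ℝ≥0∞) ^ (-(k:ℝ) * (a * s)) * x k ^ s) k
  have h2 : ∑' k : ℕ, (2:ℝ≥0∞) ^ (-(k:ℝ) * b) * x k ≤ GC (b - a) * S ^ (1 / s) := by
    unfold GC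
    rw [← ENNReal.tsum_mul_right]
    refine ENNReal.tsum_le_tsum fun k => ?_
    calc (2:ℝ≥0∞) ^ (-(k:ℝ) * b) * x k
        = (2:ℝ≥0∞) ^ (-(k:ℝ) * (b - a)) * ((2:ℝ≥0∞) ^ (-(k:ℝ) * a) * x k) := by
          rw [← mul_assoc, ← ENNReal.rpow_add _ _ (by norm_num) (by norm_num)]
          congr 2; ring
      _ ≤ _ := by gcongr; exact h1 k
  refine (ENNReal.rpow_le_rpow h2 hs.le).trans (le_of_eq ?_)
  rw [ENNReal.mul_rpow_of_nonneg _ _ hs.le, ← ENNReal.rpow_mul, one_div_mul_cancel hs.ne',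
    ENNReal.rpow_one]

lemma finsum_rpow {ι : Type*} (E : Finset ι) (x : ι → ℝ≥0∞) {s : ℝ} (hs : 0 < s) :
    (∑ e ∈ E, x e) ^ s ≤ (E.card : ℝ≥0∞) ^ s * ∑ e ∈ E, x e ^ s := by
  set S := ∑ e ∈ E, x e ^ s with hS
  have h1 : ∀ e ∈ E, x e ≤ S ^ (1 / s) := by
    intro e he
    rw [one_div, ENNReal.le_rpow_inv_iff hs]
    exact Finset.single_le_sum (f := fun e => x e ^ s) (fun _ _ => zero_le) he
  have h2 := Finset.sum_le_card_nsmul E x _ h1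
  rw [nsmul_eq_mul] at h2
  refine (ENNReal.rpow_le_rpow h2 hs.le).trans (le_of_eq ?_)
  rw [ENNReal.mul_rpow_of_nonneg _ _ hs.le, ← ENNReal.rpow_mul, one_div_mul_cancel hs.ne',
    ENNReal.rpow_one]

lemma tsum_div {n : ℕ} (k : ℕ) (e : Fin n → ℤ) (f : (Fin n → ℤ) → ℝ≥0∞) :
    ∑' m : Fin n → ℤ, f (fun i => m i / 2 ^ k + e i) = (2:ℝ≥0∞) ^ ((k:ℝ) * n) * ∑' m, f m := by
  have : NeZero (2 ^ k) := ⟨by positivity⟩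
  let E1 : (Fin n → ℤ) ≃ (Fin n → ℤ) × (Fin n → Fin (2 ^ k)) :=
    (Equiv.piCongrRight fun _ => Int.divModEquiv (2 ^ k)).trans
      (Equiv.arrowProdEquivProdArrow _ _ _)
  have h1 : ∀ m, (fun i => m i / 2 ^ k + e i) = (E1 m).1 + e := by
    intro m; ext i
    simp [E1, Int.divModEquiv, Equiv.arrowProdEquivProdArrow]
  simp_rw [h1]
  rw [E1.tsum_eq (fun z => f (z.1 + e)), ENNReal.tsum_prod']
  simp only [tsum_fintype, Finset.sum_const, nsmul_eq_mul]
  have h2 : ∑' i, f (i + e) = ∑' i, f i := (Equiv.addRight e).tsum_eq f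
  rw [ENNReal.tsum_mul_left, h2]
  congr 1
  simp
  rw [ENNReal.rpow_mul, ENNReal.rpow_natCast, ENNReal.rpow_natCast]

/-- neighbour offsets -/
def nb (n : ℕ) : Finset (Fin n → ℤ) := Fintype.piFinset fun _ => {-1, 0, 1}

lemma discrete {n : ℕ} {β r τ : ℝ} (hr : 0 < r) (hτ : 0 < τ) (hβ : (n:ℝ) / r < β) {C : ℝ≥0∞}
    (hC : C ≠ ∞) :
    ∃ C' : ℝ≥0∞, C' ≠ ∞ ∧ ∀ a b : ℤ → (Fin n → ℤ) → ℝ≥0∞,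
      (∀ ν m, b ν m ≤ C * ∑' k : ℕ, (2:ℝ≥0∞) ^ (-(k:ℝ) * β) *
        ∑ e ∈ nb n, a (ν - k) (fun i => m i / 2 ^ k + e i)) →
      (∑' ν, (∑' m, b ν m ^ r) ^ (τ / r)) ^ (1 / τ) ≤
        C' * (∑' ν, (∑' m, a ν m ^ r) ^ (τ / r)) ^ (1 / τ) := by
  obtain ⟨α, hα1, hα2⟩ := exists_between hβ
  rw [div_lt_iff₀ hr] at hα1
  have hs : 0 < τ / r := by positivity
  set γ := α * r - n with hγ
  have hγ0 : 0 < γ := by linarith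
  set C3 := C ^ r * (GC (β - α) ^ r * (((nb n).card : ℝ≥0∞) ^ r * (nb n).card)) with hC3
  have hC3t : C3 ≠ ∞ := by
    have h1 := ENNReal.rpow_ne_top_of_nonneg hr.le hC
    have h2 := ENNReal.rpow_ne_top_of_nonneg hr.le (GC_ne_top (sub_pos.mpr hα2))
    have h3 := ENNReal.rpow_ne_top_of_nonneg hr.le (ENNReal.natCast_ne_top (nb n).card)
    finiteness
  set C4 := C3 ^ (τ / r) * (GC (γ - γ / 2) ^ (τ / r) * GC (γ / 2 * (τ / r)))
  have hC4t : C4 ≠ ∞ := by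
    have h1 := ENNReal.rpow_ne_top_of_nonneg hs.le hC3t
    have h2 := ENNReal.rpow_ne_top_of_nonneg hs.le (GC_ne_top (b := γ - γ / 2) (by linarith))
    have h3 := GC_ne_top (b := γ / 2 * (τ / r)) (by positivity)
    finiteness
  refine ⟨C4 ^ (1 / τ), ENNReal.rpow_ne_top_of_nonneg (by positivity) hC4t, ?_⟩
  intro a b hab
  set A := fun ν => ∑' m, a ν m ^ r with hA
  have h1 : ∀ ν, ∑' m, b ν m ^ r ≤ C3 * ∑' k : ℕ, (2:ℝ≥0∞) ^ (-(k:ℝ) * γ) * A (ν - k) := by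
    intro ν
    have h2 : ∀ m, b ν m ^ r ≤ C ^ r * (GC (β - α) ^ r * (((nb n).card : ℝ≥0∞) ^ r *
        ∑' k : ℕ, (2:ℝ≥0∞) ^ (-(k:ℝ) * (α * r)) *
          ∑ e ∈ nb n, a (ν - k) (fun i => m i / 2 ^ k + e i) ^ r)) := by
      intro m
      refine (ENNReal.rpow_le_rpow (hab ν m) hr.le).trans ?_
      rw [ENNReal.mul_rpow_of_nonneg _ _ hr.le]
      gcongr
      refine (tsum_geo (a := α) hr).trans ?_
      gcongr
      rw [← ENNReal.tsum_mul_left]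
      refine ENNReal.tsum_le_tsum fun k => ?_
      exact (mul_le_mul_right (finsum_rpow _ _ hr) _).trans (le_of_eq (mul_left_comm _ _ _))
    refine (ENNReal.tsum_le_tsum h2).trans (le_of_eq ?_)
    rw [ENNReal.tsum_mul_left, ENNReal.tsum_mul_left, ENNReal.tsum_mul_left, ENNReal.tsum_comm, hC3]
    have h3 : ∀ k : ℕ, ∑' m : Fin n → ℤ, (2:ℝ≥0∞) ^ (-(k:ℝ) * (α * r)) *
          ∑ e ∈ nb n, a (ν - k) (fun i => m i / 2 ^ k + e i) ^ r =
        (nb n).card * ((2:ℝ≥0∞) ^ (-(k:ℝ) * γ) * A (ν - k)) := by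
      intro k
      rw [ENNReal.tsum_mul_left, Summable.tsum_finsetSum (fun _ _ => ENNReal.summable)]
      have h4 : ∀ e ∈ nb n, ∑' m : Fin n → ℤ, a (ν - k) (fun i => m i / 2 ^ k + e i) ^ r =
        (2:ℝ≥0∞) ^ ((k:ℝ) * n) * A (ν - k) := fun e _ =>
          tsum_div k e (fun m => a (ν - k) m ^ r)
      rw [Finset.sum_congr rfl h4, Finset.sum_const, nsmul_eq_mul, mul_left_comm, ← mul_assoc (2 ^ _),
        ← ENNReal.rpow_add _ _ (by norm_num) (by norm_num)]
      congr 3; rw [hγ]; ring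
    simp_rw [h3]
    rw [ENNReal.tsum_mul_left]
    ring
  have h5 : ∀ ν, (∑' m, b ν m ^ r) ^ (τ / r) ≤ C3 ^ (τ / r) * (GC (γ - γ / 2) ^ (τ / r) *
      ∑' k : ℕ, (2:ℝ≥0∞) ^ (-(k:ℝ) * (γ / 2 * (τ / r))) * A (ν - k) ^ (τ / r)) := by
    intro ν
    refine (ENNReal.rpow_le_rpow (h1 ν) hs.le).trans ?_
    rw [ENNReal.mul_rpow_of_nonneg _ _ hs.le]
    gcongr
    exact tsum_geo hs
  have h6 : ∑' ν, (∑' m, b ν m ^ r) ^ (τ / r) ≤ C4 * ∑' ν, A ν ^ (τ / r) := by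
    refine (ENNReal.tsum_le_tsum h5).trans (le_of_eq ?_)
    rw [ENNReal.tsum_mul_left, ENNReal.tsum_mul_left, ENNReal.tsum_comm]
    have h7 : ∀ k : ℕ, ∑' ν : ℤ, (2:ℝ≥0∞) ^ (-(k:ℝ) * (γ / 2 * (τ / r))) * A (ν - k) ^ (τ / r) =
        (2:ℝ≥0∞) ^ (-(k:ℝ) * (γ / 2 * (τ / r))) * ∑' ν, A ν ^ (τ / r) := by
      intro k
      have h8 : ∑' ν : ℤ, A (ν - k) ^ (τ / r) = ∑' ν, A ν ^ (τ / r) :=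
        (Equiv.subRight (k:ℤ)).tsum_eq (fun ν => A ν ^ (τ / r))
      rw [ENNReal.tsum_mul_left, h8]
    simp_rw [h7]
    rw [ENNReal.tsum_mul_right]
    simp only [C4, GC]
    ring
  refine (ENNReal.rpow_le_rpow h6 (by positivity)).trans (le_of_eq ?_)
  rw [ENNReal.mul_rpow_of_nonneg _ _ (by positivity)]

end BBMAux


namespace BBMAux

/-- The measurable equivalence between `Fin n → ℝ` and Euclidean space. -/
def TT (n : ℕ) : (Fin n → ℝ) ≃ᵐ Eucl n := MeasurableEquiv.toLp 2 (Fin n → ℝ)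

lemma TT_mp (n : ℕ) : MeasurePreserving (TT n) := PiLp.volume_preserving_toLp (Fin n)

lemma TT_apply {n : ℕ} (x : Fin n → ℝ) (i : Fin n) : TT n x i = x i := rfl

lemma TT_set {n : ℕ} (S : Set (Eucl n)) (h : Eucl n → ℝ≥0∞) :
    ∫⁻ y in S, h y = ∫⁻ x in TT n ⁻¹' S, h (TT n x) :=
  ((TT_mp n).setLIntegral_comp_preimage_emb (TT n).measurableEmbedding h S).symm

lemma TT_vol {n : ℕ} (S : Set (Eucl n)) : volume S = volume (TT n ⁻¹' S) :=
  ((TT_mp n).measure_preimage_equiv S).symm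

lemma TT_int {n : ℕ} (h : Eucl n → ℝ≥0∞) : ∫⁻ y, h y = ∫⁻ x, h (TT n x) :=
  ((TT_mp n).lintegral_comp_emb (TT n).measurableEmbedding h).symm

lemma TT_cube {n : ℕ} (x : Eucl n) {r : ℝ} (hr : 0 ≤ r) :
    TT n ⁻¹' cubeSet x r = Metric.closedBall ((TT n).symm x) r := by
  ext y
  rw [Metric.mem_closedBall, dist_pi_le_iff hr]
  simp only [Set.mem_preimage, cubeSet, Set.mem_ofPred_eq, Real.dist_eq]
  refine forall_congr' fun i => ?_
  rw [abs_sub_comm]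
  rfl

lemma apConst_le {n : ℕ} {p : ℝ} {K : ℝ≥0∞} {w : Eucl n → ℝ≥0∞}
    (h : Ap p K (fun x => w (TT n x))) : apConst n p w ≤ K := by
  unfold apConst
  refine iSup_le fun x => iSup_le fun r => iSup_le fun hr => ?_
  have := h ((TT n).symm x) r hr
  unfold av at this
  rw [← vol_cb ((TT n).symm x) hr.le] at this
  rwa [TT_vol, TT_set, TT_set, TT_cube x hr.le]

lemma one_le_ap {n : ℕ} {p : ℝ} (hp : 1 < p) {W : (Fin n → ℝ) → ℝ≥0∞} (hW : Measurable W)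
    (hP : PF W) (c : Fin n → ℝ) {r : ℝ} (hr : 0 < r) :
    1 ≤ av W c r * (av (fun y => W y ^ (-(1 / (p - 1)))) c r) ^ (p - 1) := by
  have hp0 : 0 < p := by linarith
  have hp1 : 0 < p - 1 := by linarith
  have hconj := Real.HolderConjugate.conjExponent hp
  have h := ENNReal.lintegral_mul_le_Lp_mul_Lq (volume.restrict (Metric.closedBall c r)) hconj
    (f := fun x => W x ^ (1 / p)) (g := fun x => W x ^ (-(1 / p)))
    (hW.pow_const _).aemeasurable (hW.pow_const _).aemeasurable
  have e1 : ∫⁻ x in Metric.closedBall c r,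
      ((fun x => W x ^ (1 / p)) * (fun x => W x ^ (-(1 / p)))) x = cv n r := by
    calc _ = ∫⁻ x in Metric.closedBall c r, 1 := by
          apply lintegral_congr_ae
          filter_upwards [ae_restrict_of_ae hP] with x hx
          simp only [Pi.mul_apply]
          rw [← ENNReal.rpow_add _ _ hx.1.ne' hx.2.ne]
          simp
      _ = _ := by rw [setLIntegral_one, vol_cb c hr.le]
  rw [e1] at h
  simp only [← ENNReal.rpow_mul] at h
  have e2 : -(1 / p) * p.conjExponent = -(1 / (p - 1)) := by
    rw [Real.conjExponent]; field_simp
  have e3 : 1 / p.conjExponent = (p - 1) / p := by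
    rw [Real.conjExponent]; field_simp
  rw [one_div_mul_cancel hp0.ne', e2, e3] at h
  simp only [ENNReal.rpow_one] at h
  have h2 := ENNReal.rpow_le_rpow h hp0.le
  rw [ENNReal.mul_rpow_of_nonneg _ _ hp0.le, ← ENNReal.rpow_mul, ← ENNReal.rpow_mul,
    one_div_mul_cancel hp0.ne', div_mul_cancel₀ _ hp0.ne', ENNReal.rpow_one] at h2
  unfold av
  rw [ENNReal.mul_rpow_of_nonneg _ _ hp1.le]
  have hc0 := cv_ne_zero (n := n) hr
  have hct := cv_ne_top (n := n) (r := r)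
  calc (1:ℝ≥0∞) = ((cv n r)⁻¹) ^ p * cv n r ^ p := by
        rw [← ENNReal.mul_rpow_of_nonneg _ _ hp0.le, ENNReal.inv_mul_cancel hc0 hct,
          ENNReal.one_rpow]
    _ ≤ ((cv n r)⁻¹) ^ p * _ := mul_le_mul_right h2 _
    _ = ((cv n r)⁻¹ * ((cv n r)⁻¹) ^ (p - 1)) * _ := by
        congr 1
        nth_rw 2 [← ENNReal.rpow_one (cv n r)⁻¹]
        rw [← ENNReal.rpow_add_of_nonneg _ _ (by norm_num) hp1.le]
        congr 1; ring
    _ = _ := by ring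

lemma one_le_apConst {n : ℕ} {p : ℝ} (hp : 1 < p) {w : Eucl n → ℝ≥0∞} (hw : Measurable w)
    (hP : PF (fun x => w (TT n x))) : 1 ≤ apConst n p w := by
  have h1 := one_le_ap hp (hw.comp (TT n).measurable) hP 0 one_pos
  refine h1.trans ?_
  unfold apConst
  refine le_trans ?_ (le_iSup _ (TT n 0))
  refine le_trans ?_ (le_iSup _ (1:ℝ))
  refine le_trans ?_ (le_iSup _ one_pos)
  rw [TT_vol, TT_set, TT_set, TT_cube _ zero_le_one, vol_cb _ zero_le_one]
  simp only [MeasurableEquiv.symm_apply_apply]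
  exact le_rfl

/-- The constant function associated with `N`. -/
def PhiN (p : ℝ) (N : ℝ → ℝ) (K : ℝ≥0∞) : ℝ≥0∞ := ENNReal.ofReal (N (max 1 K.toReal)) ^ p

lemma Fam_of_memF {n : ℕ} {p : ℝ} (hp : 1 < p) {N : ℝ → ℝ} (hN : MonotoneOn N (Set.Ici 1))
    {f g : Eucl n → ℝ} (h : memF n p N f g) :
    Fam p (PhiN p N) (fun x => (‖f (TT n x)‖₊ : ℝ≥0∞)) (fun x => (‖g (TT n x)‖₊ : ℝ≥0∞)) := by
  have hp0 : 0 < p := by linarith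
  intro W hW hP K hK hA
  set w : Eucl n → ℝ≥0∞ := fun y => W ((TT n).symm y) with hw
  have hwW : (fun x => w (TT n x)) = W := by ext x; simp [hw]
  have hwm : Measurable w := hW.comp (TT n).symm.measurable
  have h1 : 1 ≤ apConst n p w := one_le_apConst hp hwm (by rw [hwW]; exact hP)
  have h2 : apConst n p w ≤ K := apConst_le (by rw [hwW]; exact hA)
  have hwt : IsWeight w := by
    refine ⟨hwm, ?_⟩
    have := (TT_mp n).symm.quasiMeasurePreserving.ae hP
    exact this
  have h3 := h.2.2 w ⟨hwt, h2.trans_lt (lt_top_iff_ne_top.mpr hK)⟩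
  have hap : (apConst n p w) ≠ ∞ := ne_top_of_le_ne_top hK h2
  have h4 : N (apConst n p w).toReal ≤ N (max 1 K.toReal) := by
    have h1' : 1 ≤ (apConst n p w).toReal := by
      rw [← ENNReal.toReal_one]; exact ENNReal.toReal_mono hap h1
    exact hN (Set.mem_Ici.mpr h1') (Set.mem_Ici.mpr (le_max_left _ _)) ((ENNReal.toReal_mono hK h2).trans (le_max_right _ _))
  have h5 := h3.trans (mul_le_mul_left (ENNReal.ofReal_le_ofReal h4) _)
  have h6 := ENNReal.rpow_le_rpow h5 hp0.le
  unfold wLp wLpE at h6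
  rw [ENNReal.mul_rpow_of_nonneg _ _ hp0.le, ← ENNReal.rpow_mul, ← ENNReal.rpow_mul,
    one_div_mul_cancel hp0.ne', ENNReal.rpow_one, ENNReal.rpow_one, TT_int, TT_int] at h6
  have hwx : ∀ x, w (TT n x) = W x := fun x => congrFun hwW x
  simp only [hwx] at h6
  exact h6

/-- centre of a dyadic cube -/
def cen {n : ℕ} (ν : ℤ) (m : Fin n → ℤ) : Fin n → ℝ := fun i => (2:ℝ) ^ (-ν) * (m i + 1 / 2)

lemma TT_dy {n : ℕ} (ν : ℤ) (m : Fin n → ℤ) :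
    TT n ⁻¹' dyCube n ν m = Metric.closedBall (cen ν m) (2 ^ (-ν) / 2) := by
  ext y
  rw [Metric.mem_closedBall, dist_pi_le_iff (by positivity)]
  simp only [Set.mem_preimage, dyCube, Set.mem_ofPred_eq, Real.dist_eq, TT_apply, Set.mem_Icc, cen]
  refine forall_congr' fun i => ?_
  rw [abs_le]
  constructor
  · rintro ⟨h1, h2⟩; constructor <;> nlinarith
  · rintro ⟨h1, h2⟩; constructor <;> nlinarith

lemma vol_dy {n : ℕ} (ν : ℤ) (m : Fin n → ℤ) :
    volume (dyCube n ν m) = (2:ℝ≥0∞) ^ (-(ν:ℝ) * n) := by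
  rw [TT_vol, TT_dy, vol_cb _ (by positivity), cv, show 2 * ((2:ℝ) ^ (-ν) / 2) = 2 ^ (-ν) by ring,
    ENNReal.ofReal_pow (by positivity), ENNReal.rpow_mul, ENNReal.rpow_natCast]
  congr 1
  rw [← Real.rpow_intCast, ← ENNReal.ofReal_rpow_of_pos (by norm_num), ENNReal.ofReal_ofNat]
  push_cast
  rfl

lemma dy_cover {n : ℕ} (ν : ℤ) (m : Fin n → ℤ) (k : ℕ) :
    Metric.closedBall (cen ν m) (2 ^ (k + 1) * (2 ^ (-ν) / 2)) ⊆
      ⋃ e ∈ nb n, TT n ⁻¹' dyCube n (ν - k) (fun i => m i / 2 ^ k + e i) := by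
  intro y hy
  rw [Metric.mem_closedBall, dist_pi_le_iff (by positivity)] at hy
  have hh : (0:ℝ) < 2 ^ (-ν) := by positivity
  have hH : (2:ℝ) ^ (-(ν - (k:ℤ))) = 2 ^ k * 2 ^ (-ν) := by
    rw [neg_sub, sub_eq_add_neg, zpow_add₀ (by norm_num), zpow_natCast]
  have key : ∀ i, ∃ e : ℤ, e ∈ ({-1, 0, 1} : Finset ℤ) ∧
      y i ∈ Set.Icc ((2:ℝ) ^ (-(ν - (k:ℤ))) * ((m i / 2 ^ k + e : ℤ) : ℝ))
        ((2:ℝ) ^ (-(ν - (k:ℤ))) * (((m i / 2 ^ k + e : ℤ) : ℝ) + 1)) := by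
    intro i
    have hd := hy i
    rw [Real.dist_eq, abs_le] at hd
    simp only [cen] at hd
    have hk : (0:ℤ) < 2 ^ k := by positivity
    have hm1 := Int.ediv_mul_add_emod (m i) (2 ^ k)
    have hm2 := Int.emod_nonneg (m i) hk.ne'
    have hm3 := Int.emod_lt_of_pos (m i) hk
    set M := m i / 2 ^ k
    set s := m i % 2 ^ k
    have hm3' : s + 1 ≤ 2 ^ k := hm3
    have c1 : ((M:ℝ)) * 2 ^ k + s = m i := by exact_mod_cast hm1
    have c2 : (0:ℝ) ≤ s := by exact_mod_cast hm2
    have c3 : (s:ℝ) + 1 ≤ 2 ^ k := by exact_mod_cast hm3'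
    rw [hH]
    set h := (2:ℝ) ^ (-ν)
    rw [← c1, pow_succ] at hd
    have d2 : 0 ≤ h * s := by positivity
    have d3 : h * (s + 1) ≤ h * 2 ^ k := mul_le_mul_of_nonneg_left c3 hh.le
    set D := (2:ℝ) ^ k * h with hD
    have f1 : D * (M - 1) ≤ y i := by nlinarith
    have f2 : y i ≤ D * (M + 2) := by nlinarith
    rcases le_total (y i) (D * M) with g | g
    · refine ⟨-1, by simp, ?_, ?_⟩ <;> push_cast <;> nlinarith
    · rcases le_total (y i) (D * (M + 1)) with g' | g'
      · refine ⟨0, by simp, ?_, ?_⟩ <;> push_cast <;> nlinarith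
      · refine ⟨1, by simp, ?_, ?_⟩ <;> push_cast <;> nlinarith
  choose e he1 he2 using key
  simp only [Set.mem_iUnion]
  refine ⟨e, ?_, fun i => he2 i⟩
  rw [nb, Fintype.mem_piFinset]
  exact he1

lemma finsum_rpow_le {ι : Type*} (E : Finset ι) (x : ι → ℝ≥0∞) {s : ℝ} (hs0 : 0 < s)
    (hs1 : s ≤ 1) : (∑ k ∈ E, x k) ^ s ≤ ∑ k ∈ E, x k ^ s := by
  induction E using Finset.cons_induction with
  | empty => simp [hs0]
  | cons a t ha ih =>
    rw [Finset.sum_cons, Finset.sum_cons]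
    exact (ENNReal.rpow_add_le_add_rpow _ _ hs0.le hs1).trans (add_le_add le_rfl ih)

lemma lint_cover {n : ℕ} (G : (Fin n → ℝ) → ℝ≥0∞) (ν : ℤ) (m : Fin n → ℤ) (k : ℕ) :
    ∫⁻ x in Metric.closedBall (cen ν m) (2 ^ (k + 1) * (2 ^ (-ν) / 2)), G x ≤
      ∑ e ∈ nb n, ∫⁻ x in TT n ⁻¹' dyCube n (ν - k) (fun i => m i / 2 ^ k + e i), G x := by
  refine (lintegral_mono_set (dy_cover ν m k)).trans ?_
  have := lintegral_iUnion_le (μ := volume)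
    (fun e : nb n => TT n ⁻¹' dyCube n (ν - k) (fun i => m i / 2 ^ k + e.1 i)) G
  rw [Set.iUnion_subtype, tsum_fintype, Finset.sum_coe_sort (nb n)
    (fun e => ∫⁻ x in TT n ⁻¹' dyCube n (ν - k) (fun i => m i / 2 ^ k + e i), G x)] at this
  exact this

end BBMAux

/-- **Extrapolation in Besov–Bourgain–Morrey spaces `BM^{p,τ}_{q,r}`,
`1 < q < p < r < ∞`, `1 ≤ τ < ∞`.** -/
theorem extrapolation_bbm (n : ℕ) (hn : 1 ≤ n) (p q r τ : ℝ)
    (hq : 1 < q) (hqp : q < p) (hpr : p < r) (hτ : 1 ≤ τ)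
    (p₀ : ℝ) (hp₀ : 1 < p₀)
    (N : ℝ → ℝ) (hN : MonotoneOn N (Set.Ici 1)) (hNpos : ∀ t, 1 ≤ t → 0 < N t) :
    ∃ C : ℝ, 0 < C ∧ ∀ f g : Eucl n → ℝ, memF n p₀ N f g →
      bbmNorm n p q r τ f ≤ ENNReal.ofReal C * bbmNorm n p q r τ g := by
  have hq0 : 0 < q := by linarith
  have hp0 : 0 < p := by linarith
  have hr0 : 0 < r := by linarith
  have hn0 : (0:ℝ) < n := by exact_mod_cast hn
  obtain ⟨θ, hθ0, hθ1, hθ⟩ : ∃ θ : ℝ, 0 < θ ∧ θ < 1 ∧ 1 / r < θ / q + (1 / p - 1 / q) := by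
    have h1 : 1 / r < 1 / p := one_div_lt_one_div_of_lt hp0 hpr
    have h2 : 0 < 1 / r := by positivity
    have h3 : 1 / p < 1 / q := one_div_lt_one_div_of_lt hq0 hqp
    have h4 : q * (1 / q) = 1 := by field_simp
    refine ⟨1 - q * (1 / p - 1 / r) / 2, by nlinarith, by nlinarith, ?_⟩
    have h5 : (1 - q * (1 / p - 1 / r) / 2) / q = 1 / q - (1 / p - 1 / r) / 2 := by
      field_simp
    rw [h5]; linarith
  have hΦ : ∀ K, BBMAux.PhiN p₀ N K ≠ ∞ := fun K =>
    ENNReal.rpow_ne_top_of_nonneg (by linarith) ENNReal.ofReal_ne_top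
  obtain ⟨C0, hC0, hloc⟩ := BBMAux.local_all (n := n) hp₀ hq hθ0 hθ1 hΦ
  set β : ℝ := n * (θ / q + (1 / p - 1 / q)) with hβdef
  have hβ : (n:ℝ) / r < β := by
    rw [hβdef, div_eq_mul_one_div]
    exact mul_lt_mul_of_pos_left hθ hn0
  obtain ⟨C1, hC1, hdis⟩ := BBMAux.discrete (n := n) (τ := τ) hr0 (by linarith) hβ hC0
  refine ⟨C1.toReal + 1, by positivity, fun f g hfg => ?_⟩
  have hC : C1 ≤ ENNReal.ofReal (C1.toReal + 1) := by
    rw [ENNReal.le_ofReal_iff_toReal_le hC1 (by positivity)]; linarith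
  refine le_trans ?_ (mul_le_mul_left hC _)
  unfold bbmNorm
  refine hdis _ _ fun ν m => ?_
  have hF : Measurable (fun x => (‖f (BBMAux.TT n x)‖₊ : ℝ≥0∞)) :=
    (hfg.1.comp (BBMAux.TT n).measurable).nnnorm.coe_nnreal_ennreal
  have hG : Measurable (fun x => (‖g (BBMAux.TT n x)‖₊ : ℝ≥0∞)) :=
    (hfg.2.1.comp (BBMAux.TT n).measurable).nnnorm.coe_nnreal_ennreal
  have h1 := hloc _ _ hF hG (BBMAux.Fam_of_memF hp₀ hN hfg) (BBMAux.cen ν m) (2 ^ (-ν) / 2)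
    (by positivity)
  rw [BBMAux.TT_set, BBMAux.TT_dy]
  refine (mul_le_mul_right h1 _).trans ?_
  rw [mul_left_comm, ← ENNReal.tsum_mul_left]
  refine mul_le_mul_right (ENNReal.tsum_le_tsum fun k => ?_) _
  have h2 : (∫⁻ x in Metric.closedBall (BBMAux.cen ν m) (2 ^ (k + 1) * (2 ^ (-ν) / 2)),
      (‖g (BBMAux.TT n x)‖₊ : ℝ≥0∞) ^ q) ^ (1 / q) ≤
      ∑ e ∈ BBMAux.nb n, (∫⁻ y in dyCube n (ν - k) (fun i => m i / 2 ^ k + e i),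
        (‖g y‖₊ : ℝ≥0∞) ^ q) ^ (1 / q) := by
    refine (ENNReal.rpow_le_rpow (BBMAux.lint_cover _ ν m k) (by positivity)).trans ?_
    refine (BBMAux.finsum_rpow_le _ _ (by positivity)
      (by rw [div_le_one hq0]; exact hq.le)).trans (le_of_eq ?_)
    refine Finset.sum_congr rfl fun e _ => ?_
    rw [BBMAux.TT_set]
  have h3 : volume (dyCube n ν m) ^ (1 / p - 1 / q) * (2:ℝ≥0∞) ^ (-((k:ℝ) * n) * (θ / q)) =
      (2:ℝ≥0∞) ^ (-(k:ℝ) * β) * ((2:ℝ≥0∞) ^ (-((ν - k : ℤ):ℝ) * n)) ^ (1 / p - 1 / q) := by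
    rw [BBMAux.vol_dy, ← ENNReal.rpow_mul, ← ENNReal.rpow_mul,
      ← ENNReal.rpow_add _ _ (by norm_num) (by norm_num),
      ← ENNReal.rpow_add _ _ (by norm_num) (by norm_num)]
    congr 1
    rw [hβdef]
    push_cast
    ring
  simp only [BBMAux.vol_dy (ν - k)]
  rw [← Finset.mul_sum, ← mul_assoc, ← mul_assoc, h3]
  exact mul_le_mul_right h2 _
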